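/- arXiv:2209.14416 — 2 statements merged into one kernel-verified Lean document; each statement's English description precedes it below -/
import Mathlib

section
/- Let Q = diag(Q_1, …, Q_N) be diagonal. Applying ϖ coefficientwise, ϖ(𝒟_Q(u, ∂_u)) = (𝒟̃_𝖰(u, ∂_u))^{−1}; that is, ϖ(𝒟_Q(u, ∂_u)) · 𝒟̃_𝖰(u, ∂_u) = 𝒟̃_𝖰(u, ∂_u) · ϖ(𝒟_Q(u, ∂_u)) = 1 in the algebra of formal difference operators Σ_{k≥0} a_k(u) e^{−k∂_u} with a_k(u) ∈ Y(gl_{n|m})[[u^{−1}]] and relation e^{−∂_u} f(u) = f(u−1) e^{−∂_u}. -/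
noncomputable section
namespace Paper

def parN (m : ℕ) (c : ℕ) : ℕ := if c < m then 0 else 1
def par (m : ℕ) {N : ℕ} (a : Fin N) : ℕ := parN m a

section Super
variable {R : Type} [Ring R] [Algebra ℂ R] {ι : Type} [Fintype ι] [DecidableEq ι] {N : ℕ}

def mpar (m : ℕ) (r : ι → Fin N) : ℕ := ∑ v, par m (r v)

def sMul (m : ℕ) (A B : Matrix (ι → Fin N) (ι → Fin N) R) :
    Matrix (ι → Fin N) (ι → Fin N) R := fun r t =>
  ∑ s : ι → Fin N, ((-1 : R) ^ ((mpar m s + mpar m t) * (mpar m r + mpar m s))) * A r s * B s t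

def invExp (m : ℕ) (lt : ι → ι → Prop) [DecidableRel lt] (σ : Equiv.Perm ι)
    (s : ι → Fin N) : ℕ :=
  ∑ p ∈ Finset.univ.filter (fun p : ι × ι => lt p.1 p.2 ∧ lt (σ p.2) (σ p.1)),
    par m (s p.1) * par m (s p.2)

def permMat (m : ℕ) (lt : ι → ι → Prop) [DecidableRel lt] (σ : Equiv.Perm ι) :
    Matrix (ι → Fin N) (ι → Fin N) R := fun r s =>
  if r = s ∘ σ.symm then (-1 : R) ^ invExp m lt σ s else 0

def embed (m : ℕ) (lt : ι → ι → Prop) [DecidableRel lt] (v : ι) (f : Fin N → Fin N → R) :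
    Matrix (ι → Fin N) (ι → Fin N) R := fun r s =>
  if ∀ w, w ≠ v → r w = s w then
    ((-1 : R) ^ ((par m (r v) + par m (s v)) *
        ∑ w ∈ Finset.univ.filter (fun w => lt w v), par m (s w))) * f (r v) (s v)
  else 0

def strace (m : ℕ) (M : Matrix (ι → Fin N) (ι → Fin N) R) : R :=
  ∑ r : ι → Fin N, (-1 : R) ^ mpar m r * M r r

def shiftCoeff (z : ℂ) (p s : ℕ) : ℂ := ((p - 1).choose (p - s) : ℂ) * z ^ (p - s)

def serMul (m : ℕ) (F G : ℕ → Matrix (ι → Fin N) (ι → Fin N) R) :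
    ℕ → Matrix (ι → Fin N) (ι → Fin N) R :=
  fun p => ∑ q ∈ Finset.range (p + 1), sMul m (F q) (G (p - q))

def serOne : ℕ → Matrix (ι → Fin N) (ι → Fin N) R := fun p => if p = 0 then 1 else 0

def serProd (m : ℕ) (l : List (ℕ → Matrix (ι → Fin N) (ι → Fin N) R)) :
    ℕ → Matrix (ι → Fin N) (ι → Fin N) R := l.foldl (serMul m) serOne

def kron (Q : Matrix (Fin N) (Fin N) ℂ) : Matrix (ι → Fin N) (ι → Fin N) ℂ :=
  fun r s => ∏ v, Q (r v) (s v)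

end Super

def symmZ (m : ℕ) (N k : ℕ) : Matrix (Fin k → Fin N) (Fin k → Fin N) ℂ :=
  ((k.factorial : ℂ))⁻¹ • ∑ σ : Equiv.Perm (Fin k), permMat m (· < ·) σ

def asymmZ (m : ℕ) (N k : ℕ) : Matrix (Fin k → Fin N) (Fin k → Fin N) ℂ :=
  ((k.factorial : ℂ))⁻¹ •
    ∑ σ : Equiv.Perm (Fin k), (((Equiv.Perm.sign σ : ℤ) : ℂ)) • permMat m (· < ·) σ

/- ----------------  The super Yangian  ---------------- -/

abbrev YGen (N : ℕ) := Fin N × Fin N × ℕ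

def Tfree {N : ℕ} (a b : Fin N) : ℕ → FreeAlgebra ℂ (YGen N)
  | 0 => if a = b then 1 else 0
  | s + 1 => FreeAlgebra.ι ℂ (a, b, s)

inductive YRel (m n : ℕ) :
    FreeAlgebra ℂ (YGen (m + n)) → FreeAlgebra ℂ (YGen (m + n)) → Prop
  | rtt (a b c d : Fin (m + n)) (r s : ℕ) :
      YRel m n
        ((Tfree a b (r + 1) * Tfree c d s -
            ((-1 : ℂ) ^ ((par m a + par m b) * (par m c + par m d))) •
              (Tfree c d s * Tfree a b (r + 1)))
          - (Tfree a b r * Tfree c d (s + 1) -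
            ((-1 : ℂ) ^ ((par m a + par m b) * (par m c + par m d))) •
              (Tfree c d (s + 1) * Tfree a b r)))
        (((-1 : ℂ) ^ (par m a * par m c + par m a * par m d + par m c * par m d)) •
          (Tfree c b s * Tfree a d r - Tfree c b r * Tfree a d s))

abbrev Yangian (m n : ℕ) := RingQuot (YRel m n)

def TT (m n : ℕ) (a b : Fin (m + n)) (s : ℕ) : Yangian m n :=
  RingQuot.mkAlgHom ℂ (YRel m n) (Tfree a b s)

/-- The series `T^{(v, ι∪{∗})}(u - z)` as a matrix power series over the Yangian. -/
def TfacY (m n : ℕ) {ι : Type} [Fintype ι] [DecidableEq ι]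
    (lt : ι → ι → Prop) [DecidableRel lt] (v : ι) (z : ℂ) :
    ℕ → Matrix (ι → Fin (m + n)) (ι → Fin (m + n)) (Yangian m n) :=
  fun p => embed m lt v
    (fun a b => ∑ s ∈ Finset.range (p + 1),
      algebraMap ℂ (Yangian m n) (shiftCoeff z p s) * TT m n a b s)

/-- The series `T^{(k,k+1)}(u) ⋯ T^{(1,k+1)}(u-k+1)` on `V^{⊗k}` (Yangian in the last slot). -/
def TwedgeProd (m n k : ℕ) :
    ℕ → Matrix (Fin k → Fin (m + n)) (Fin k → Fin (m + n)) (Yangian m n) :=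
  serProd m (((List.finRange k).reverse).map fun i =>
    TfacY m n (· < ·) i ((k : ℂ) - 1 - (i : ℕ)))

/-- The series `T^{(1,k+1)}(u) ⋯ T^{(k,k+1)}(u-k+1)` on `V^{⊗k}`. -/
def TsymProd (m n k : ℕ) :
    ℕ → Matrix (Fin k → Fin (m + n)) (Fin k → Fin (m + n)) (Yangian m n) :=
  serProd m ((List.finRange k).map fun i => TfacY m n (· < ·) i ((i : ℕ) : ℂ))

/-- Coefficients of the transfer matrix `𝒯_{k,Q}(u) = str_{V^{∧k}}(Q^{∧k} T^{∧k}(u))`. -/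
def transferT (m n k : ℕ) (Q : Matrix (Fin (m + n)) (Fin (m + n)) ℂ) : ℕ → Yangian m n :=
  fun p => if k = 0 then (if p = 0 then 1 else 0) else
    strace m (sMul m ((asymmZ m (m + n) k).map (algebraMap ℂ (Yangian m n)))
      (sMul m ((kron (ι := Fin k) Q).map (algebraMap ℂ (Yangian m n))) (TwedgeProd m n k p)))

/-- Coefficients of the transfer matrix
`𝔗_{k,Q}(u) = str_{V^{⊗k}}(H_k Q^{(1)}⋯Q^{(k)} T^{(1,k+1)}(u)⋯T^{(k,k+1)}(u-k+1))`. -/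
def transferS (m n k : ℕ) (Q : Matrix (Fin (m + n)) (Fin (m + n)) ℂ) : ℕ → Yangian m n :=
  fun p => if k = 0 then (if p = 0 then 1 else 0) else
    strace m (sMul m ((symmZ m (m + n) k).map (algebraMap ℂ (Yangian m n)))
      (sMul m ((kron (ι := Fin k) Q).map (algebraMap ℂ (Yangian m n))) (TsymProd m n k p)))


def dualIdx {m n : ℕ} (a : Fin (m + n)) : Fin (n + m) := Fin.cast (Nat.add_comm m n) a.rev

section Dop
variable {R : Type} [Ring R] [Algebra ℂ R]

/-- Cauchy product of power series in `u^{-1}`. -/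
def serMulS (F G : ℕ → R) : ℕ → R := fun p => ∑ q ∈ Finset.range (p + 1), F q * G (p - q)

/-- The shifted series `F(u-z)`. -/
def serShiftS (z : ℂ) (F : ℕ → R) : ℕ → R :=
  fun p => ∑ s ∈ Finset.range (p + 1), shiftCoeff z p s • F s

/-- Product of formal difference operators `Σ_{k≥0} a_k(u) e^{-k ∂_u}`, where
`e^{-∂_u} f(u) = f(u-1) e^{-∂_u}`. -/
def dopMulS (F G : ℕ → ℕ → R) : ℕ → ℕ → R :=
  fun k p => ∑ i ∈ Finset.range (k + 1), serMulS (F i) (serShiftS (i : ℂ) (G (k - i))) p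

/-- The identity difference operator. -/
def dopOneS : ℕ → ℕ → R := fun k p => if k = 0 ∧ p = 0 then 1 else 0

end Dop

/-- The rational difference operator `𝒟_Q(u, ∂_u) = Σ_{k≥0} (-1)^k 𝒯_{k,Q}(u) e^{-k∂_u}`,
given by its coefficients at `e^{-k∂_u} u^{-p}`. -/
def DQop (m n : ℕ) (Q : Matrix (Fin (m + n)) (Fin (m + n)) ℂ) : ℕ → ℕ → Yangian m n :=
  fun k p => ((-1 : ℂ) ^ k) • transferT m n k Q p

section Master
open Equiv

/-- The permutations of `α` that fix every point outside `S`. -/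
def permsOn {α : Type*} [Fintype α] [DecidableEq α] (S : Finset α) : Finset (Perm α) :=
  Finset.univ.filter fun σ => ∀ x, x ∉ S → σ x = x

section PermsOn
variable {α : Type*} [Fintype α] [DecidableEq α] {A : Type*} [AddCommGroup A]

theorem mem_permsOn {S : Finset α} {σ : Perm α} : σ ∈ permsOn S ↔ ∀ x, x ∉ S → σ x = x := by
  simp [permsOn]

theorem swap_mem_permsOn {S : Finset α} {a b : α} (ha : a ∈ S) (hb : b ∈ S) :
    swap a b ∈ permsOn S :=
  mem_permsOn.2 fun _ hx => swap_apply_of_ne_of_ne (ne_of_mem_of_not_mem ha hx).symm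
    (ne_of_mem_of_not_mem hb hx).symm

theorem mul_mem_permsOn {S : Finset α} {σ τ : Perm α} (hσ : σ ∈ permsOn S)
    (hτ : τ ∈ permsOn S) : σ * τ ∈ permsOn S :=
  mem_permsOn.2 fun x hx => by
    rw [Perm.mul_apply, mem_permsOn.1 hτ x hx, mem_permsOn.1 hσ x hx]

theorem inv_mem_permsOn {S : Finset α} {σ : Perm α} (hσ : σ ∈ permsOn S) :
    σ⁻¹ ∈ permsOn S :=
  mem_permsOn.2 fun x hx => Perm.inv_eq_iff_eq.2 (mem_permsOn.1 hσ x hx).symm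

theorem commute_of_mem_permsOn {S T : Finset α} (h : Disjoint S T) {σ τ : Perm α}
    (hσ : σ ∈ permsOn S) (hτ : τ ∈ permsOn T) : σ * τ = τ * σ := by
  refine (Perm.Disjoint.commute fun x => ?_).eq
  by_cases hx : x ∈ S
  · exact Or.inr (mem_permsOn.1 hτ x (Finset.disjoint_left.1 h hx))
  · exact Or.inl (mem_permsOn.1 hσ x hx)

theorem sum_permsOn_mul_left {S : Finset α} {w : Perm α} (hw : w ∈ permsOn S)
    (f : Perm α → A) : ∑ h ∈ permsOn S, f (w * h) = ∑ h ∈ permsOn S, f h :=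
  Finset.sum_bij' (fun h _ => w * h) (fun h _ => w⁻¹ * h)
    (fun _ hh => mul_mem_permsOn hw hh) (fun _ hh => mul_mem_permsOn (inv_mem_permsOn hw) hh)
    (by simp) (by simp) (by simp)

theorem sum_permsOn_mul_right {S : Finset α} {w : Perm α} (hw : w ∈ permsOn S)
    (f : Perm α → A) : ∑ h ∈ permsOn S, f (h * w) = ∑ h ∈ permsOn S, f h :=
  Finset.sum_bij' (fun h _ => h * w) (fun h _ => h * w⁻¹)
    (fun _ hh => mul_mem_permsOn hh hw) (fun _ hh => mul_mem_permsOn hh (inv_mem_permsOn hw))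
    (by simp) (by simp) (by simp)

theorem sum_permsOn_inv (S : Finset α) (f : Perm α → A) :
    ∑ h ∈ permsOn S, f h⁻¹ = ∑ h ∈ permsOn S, f h :=
  Finset.sum_bij' (fun h _ => h⁻¹) (fun h _ => h⁻¹)
    (fun _ hh => inv_mem_permsOn hh) (fun _ hh => inv_mem_permsOn hh)
    (by simp) (by simp) (by simp)

theorem sum_permsOn_insert {S : Finset α} {a : α} (ha : a ∉ S) (f : Perm α → A) :
    ∑ h ∈ permsOn (insert a S), f h =
      ∑ h ∈ permsOn S, f h + ∑ b ∈ S, ∑ h ∈ permsOn S, f (swap a b * h) := by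
  have key : ∑ h ∈ permsOn (insert a S), f h =
      ∑ b ∈ insert a S, ∑ h ∈ permsOn S, f (swap a b * h) := by
    rw [← Finset.sum_product']
    refine Finset.sum_bij' (fun h _ => (h a, swap a (h a) * h)) (fun q _ => swap a q.1 * q.2)
      ?_ ?_ ?_ ?_ ?_
    · intro h hh
      rw [mem_permsOn] at hh
      simp only [Finset.mem_product, mem_permsOn]
      constructor
      · by_contra hc
        have := h.injective (hh _ hc)
        exact hc (this.symm ▸ Finset.mem_insert_self _ _)
      · intro x hx
        by_cases hxa : x = a
        · subst hxa; simp
        · have hx' : h x = x := hh x (by simp [hx, hxa])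
          rw [Perm.mul_apply, hx', swap_apply_of_ne_of_ne hxa]
          intro hc
          exact hxa (h.injective (hx'.trans hc))
    · rintro ⟨b, h⟩ hq
      simp only [Finset.mem_product, mem_permsOn] at hq
      refine mul_mem_permsOn (swap_mem_permsOn (Finset.mem_insert_self _ _) hq.1) ?_
      exact mem_permsOn.2 fun x hx => hq.2 x fun hc => hx (Finset.mem_insert_of_mem hc)
    · intro h _
      simp [← mul_assoc]
    · rintro ⟨b, h⟩ hq
      simp only [Finset.mem_product, mem_permsOn] at hq
      simp [hq.2 a ha, ← mul_assoc]
    · intro h _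
      simp [← mul_assoc]
  rw [key, Finset.sum_insert ha]
  simp only [swap_self, ← Perm.one_def, one_mul]

end PermsOn

variable {k : ℕ} {A : Type*} [AddCommGroup A] [Module ℂ A]

/-- Invariance of a functional on `S_k` modulo the elements `(1 - s) X (1 + s)`,
`s` an adjacent transposition. -/
def IsManin (F : Perm (Fin k) → A) : Prop :=
  ∀ x y : Fin k, (x : ℕ) + 1 = y → ∀ σ : Perm (Fin k),
    F σ + F (σ * swap x y) = F (swap x y * σ) + F (swap x y * σ * swap x y)

theorem IsManin.twist {F : Perm (Fin k) → A} (hF : IsManin F) :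
    IsManin fun σ => ((Perm.sign σ : ℤ) : ℂ) • F σ⁻¹ := by
  intro x y hxy σ
  have hne : x ≠ y := by rintro rfl; omega
  have := hF x y hxy σ⁻¹
  simp only [Perm.sign_mul, Perm.sign_swap hne, mul_inv_rev, swap_inv, ← mul_assoc]
  simp only [Units.val_neg, mul_neg, mul_one, neg_mul, one_mul, Int.cast_neg, neg_neg, neg_smul]
  rw [← sub_eq_add_neg, neg_add_eq_sub, ← smul_sub, ← smul_sub]
  congr 1
  rw [sub_eq_sub_iff_add_eq_add, this, add_comm]

theorem IsManin.sum_swap_adj {F : Perm (Fin k) → A} (hF : IsManin F) {S : Finset (Fin k)}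
    {x y : Fin k} (hxy : (x : ℕ) + 1 = y) (hx : x ∈ S) (hy : y ∈ S) (σ : Perm (Fin k)) :
    ∑ h ∈ permsOn S, F (swap x y * (σ * h)) = ∑ h ∈ permsOn S, F (σ * h) := by
  have h1 := sum_permsOn_mul_right (swap_mem_permsOn hx hy) fun h => F (σ * h)
  have h2 := sum_permsOn_mul_right (swap_mem_permsOn hx hy) fun h => F (swap x y * (σ * h))
  have h3 : ∑ h ∈ permsOn S, (F (σ * h) + F (σ * (h * swap x y))) =
      ∑ h ∈ permsOn S, (F (swap x y * (σ * h)) + F (swap x y * (σ * (h * swap x y)))) :=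
    Finset.sum_congr rfl fun h _ => by simpa only [mul_assoc] using hF x y hxy (σ * h)
  rw [Finset.sum_add_distrib, Finset.sum_add_distrib, h1, h2, ← two_smul ℂ, ← two_smul ℂ] at h3
  exact ((smul_right_injective A (two_ne_zero : (2 : ℂ) ≠ 0)) h3).symm

theorem IsManin.sum_swap {F : Perm (Fin k) → A} (hF : IsManin F) {S : Finset (Fin k)}
    (hS : ∀ x ∈ S, ∀ y ∈ S, ∀ z, x ≤ z → z ≤ y → z ∈ S)
    {x y : Fin k} (hxy : x ≤ y) (hx : x ∈ S) (hy : y ∈ S) (σ : Perm (Fin k)) :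
    ∑ h ∈ permsOn S, F (swap x y * (σ * h)) = ∑ h ∈ permsOn S, F (σ * h) := by
  obtain ⟨e, he⟩ : ∃ e : ℕ, (y : ℕ) = x + e := ⟨y - x, by have : (x : ℕ) ≤ y := hxy; omega⟩
  induction e generalizing y σ with
  | zero => obtain rfl : x = y := Fin.ext (by omega); simp only [swap_self, ← Perm.one_def, one_mul]
  | succ e ih =>
    let z : Fin k := ⟨x + e, by have := y.2; omega⟩
    have hz : z ∈ S := hS x hx y hy z (Fin.le_def.2 (by simp [z])) (Fin.le_def.2 (by simp [z]; omega))
    have hzy : (z : ℕ) + 1 = y := by simp [z]; omega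
    have hxz : x ≤ z := Fin.le_def.2 (by simp [z])
    have hnexy : x ≠ y := by rintro rfl; omega
    have hnezy : z ≠ y := by rintro h; rw [h] at hzy; omega
    by_cases hnexz : x = z
    · rw [hnexz]; exact hF.sum_swap_adj hzy hz hy σ
    have hconj : swap x y = swap z y * swap x z * swap z y := by
      rw [swap_mul_swap_mul_swap hnexz hnexy, swap_comm y x]
    have h1 := hF.sum_swap_adj hzy hz hy (swap x z * (swap z y * σ))
    have h2 := ih hxz hz (swap z y * σ) rfl
    have h3 := hF.sum_swap_adj hzy hz hy σ
    simp only [mul_assoc] at h1 h2 h3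
    simp only [hconj, mul_assoc]
    rw [h1, h2, h3]

theorem IsManin.sum_insert {F : Perm (Fin k) → A} (hF : IsManin F) {S T : Finset (Fin k)}
    (hS : ∀ x ∈ S, ∀ y ∈ S, ∀ z, x ≤ z → z ≤ y → z ∈ S) (hST : Disjoint S T)
    {a e : Fin k} (ha : a ∉ S) (he : e ∈ S) (c : Perm (Fin k) → ℂ) :
    ∑ τ ∈ permsOn T, ∑ h ∈ permsOn (insert a S), c τ • F (τ * h) =
      ∑ τ ∈ permsOn T, ∑ h ∈ permsOn S, c τ • F (τ * h) +
      (S.card : ℂ) • ∑ τ ∈ permsOn T, ∑ h ∈ permsOn S, c τ • F (τ * (swap a e * h)) := by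
  rw [Nat.cast_smul_eq_nsmul, Finset.smul_sum, ← Finset.sum_add_distrib]
  refine Finset.sum_congr rfl fun τ hτ => ?_
  rw [sum_permsOn_insert ha, ← Finset.sum_const]
  congr 1
  refine Finset.sum_congr rfl fun b hb => ?_
  rw [← Finset.smul_sum, ← Finset.smul_sum]
  congr 1
  have hae : a ≠ e := fun h => ha (h ▸ he)
  have hconj : ∀ h : Perm (Fin k),
      τ * (swap a b * (swap b e * h)) = swap b e * (τ * (swap a e) * h) := by
    intro h
    have h1 : swap a b * swap b e = swap b e * swap a e := by
      rw [mul_swap_eq_swap_mul (swap b e), swap_apply_right,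
        swap_apply_of_ne_of_ne (ne_of_mem_of_not_mem hb ha).symm hae]
    have h2 := commute_of_mem_permsOn hST (swap_mem_permsOn hb he) hτ
    rw [← mul_assoc (swap a b), h1, ← mul_assoc τ, ← mul_assoc τ, ← h2]
    simp only [mul_assoc]
  rw [← sum_permsOn_mul_left (swap_mem_permsOn hb he)]
  simp only [hconj]
  have : ∑ h ∈ permsOn S, F (swap b e * (τ * swap a e * h)) =
      ∑ h ∈ permsOn S, F (τ * swap a e * h) := by
    rcases le_total b e with hbe | hbe
    · exact hF.sum_swap hS hbe hb he _
    · rw [swap_comm b e]; exact hF.sum_swap hS hbe he hb _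
  simp only [this]
  simp only [mul_assoc]

theorem sum_range_telescope {A : Type*} [AddCommGroup A] [Module ℂ A] {k : ℕ} (hk : k ≠ 0)
    (x b : ℕ → A) (h : ∀ i ≤ k, (k : ℂ) • x i = (i : ℂ) • b i + ((k - i : ℕ) : ℂ) • b (i + 1)) :
    ∑ i ∈ Finset.range (k + 1),
      ((-1 : ℂ) ^ (k - i) * ((i.factorial : ℂ) * ((k - i).factorial : ℂ))⁻¹) • x i = 0 := by
  set d : ℕ → A := fun i => if i = 0 ∨ k < i then 0 else
    ((-1 : ℂ) ^ (k - i) * (((i - 1).factorial : ℂ) * ((k - i).factorial : ℂ))⁻¹) • b i with hd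
  have hstep : ∀ i ∈ Finset.range (k + 1),
      (k : ℂ) • (((-1 : ℂ) ^ (k - i) * ((i.factorial : ℂ) * ((k - i).factorial : ℂ))⁻¹) • x i)
        = d i - d (i + 1) := by
    intro i hi
    have hi' : i ≤ k := by simpa [Nat.lt_succ_iff] using hi
    rw [smul_comm, h i hi', smul_add, smul_smul, smul_smul, sub_eq_add_neg]
    congr 1
    · rcases i with _ | i
      · simp [hd]
      · have hlt : ¬ k < i + 1 := by omega
        simp only [hd, Nat.add_eq_zero_iff, one_ne_zero, and_false, hlt, or_self, if_false,
          Nat.add_sub_cancel, Nat.factorial_succ]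
        congr 1
        push_cast
        field_simp
    · rcases Nat.lt_or_eq_of_le hi' with hlt | rfl
      · obtain ⟨j, rfl⟩ : ∃ j, k = i + 1 + j := ⟨k - (i + 1), by omega⟩
        have h1 : i + 1 + j - i = j + 1 := by omega
        have h2 : ¬ (i + 1 + j < i + 1) := by omega
        simp only [hd, Nat.add_eq_zero_iff, one_ne_zero, and_false, h2, or_self, if_false,
          Nat.add_sub_cancel, Nat.factorial_succ, h1, Nat.add_sub_cancel_left]
        rw [← neg_smul]
        congr 1
        push_cast
        field_simp
        ring
      · simp [hd]
  have hk' : (k : ℂ) ≠ 0 := Nat.cast_ne_zero.2 hk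
  refine smul_right_injective A hk' ?_
  simp only [Finset.smul_sum, smul_zero]
  rw [Finset.sum_congr rfl hstep, Finset.sum_range_sub']
  simp [hd]

/-- The positions below `i`. -/
def low (k i : ℕ) : Finset (Fin k) := Finset.univ.filter fun x => (x : ℕ) < i

/-- The positions from `i` on. -/
def high (k i : ℕ) : Finset (Fin k) := Finset.univ.filter fun x => i ≤ (x : ℕ)

theorem disjoint_low_high (k i : ℕ) : Disjoint (low k i) (high k i) := by
  rw [Finset.disjoint_left]
  intro x
  simp [low, high]

theorem card_low {k i : ℕ} (h : i ≤ k) : (low k i).card = i := by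
  have : low k i = Finset.univ.map (Fin.castLEEmb h) := by
    ext x
    simp only [low, Finset.mem_filter, Finset.mem_univ, true_and, Finset.mem_map,
      Fin.castLEEmb_apply]
    exact ⟨fun hx => ⟨⟨x, hx⟩, rfl⟩, by rintro ⟨y, rfl⟩; exact y.2⟩
  rw [this, Finset.card_map, Finset.card_fin]

theorem card_high {k i : ℕ} (h : i ≤ k) : (high k i).card = k - i := by
  have : high k i = (low k i)ᶜ := by ext x; simp [low, high]
  rw [this, Finset.card_compl, card_low h, Fintype.card_fin]

theorem IsManin.sum_low_high {F : Perm (Fin k) → A} (hF : IsManin F) (hk : k ≠ 0) :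
    ∑ i ∈ Finset.range (k + 1),
      ((-1 : ℂ) ^ (k - i) * ((i.factorial : ℂ) * ((k - i).factorial : ℂ))⁻¹) •
        ∑ τ ∈ permsOn (high k i), ∑ h ∈ permsOn (low k i),
          ((Perm.sign τ : ℤ) : ℂ) • F (τ * h) = 0 := by
  refine sum_range_telescope hk _ (fun i => ∑ τ ∈ permsOn (high k (i - 1)),
    ∑ h ∈ permsOn (low k i), ((Perm.sign τ : ℤ) : ℂ) • F (τ * h)) fun i hi => ?_
  set X := ∑ τ ∈ permsOn (high k i), ∑ h ∈ permsOn (low k i),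
    ((Perm.sign τ : ℤ) : ℂ) • F (τ * h) with hX
  have hconvL : ∀ i, ∀ x ∈ low k i, ∀ y ∈ low k i, ∀ z, x ≤ z → z ≤ y → z ∈ low k i := by
    intro i x hx y hy z hxz hzy
    simp only [low, Finset.mem_filter, Finset.mem_univ, true_and, Fin.le_def] at *
    omega
  have hconvH : ∀ i, ∀ x ∈ high k i, ∀ y ∈ high k i, ∀ z, x ≤ z → z ≤ y → z ∈ high k i := by
    intro i x hx y hy z hxz hzy
    simp only [high, Finset.mem_filter, Finset.mem_univ, true_and, Fin.le_def] at *
    omega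
  have hlow0 : permsOn (low k 0) = {1} := by
    ext σ; simp [mem_permsOn, low, Equiv.ext_iff]
  have hlow1 : permsOn (low k 1) = {1} := by
    ext σ
    simp only [mem_permsOn, low, Finset.mem_filter, Finset.mem_univ, true_and,
      Finset.mem_singleton, Nat.lt_one_iff]
    refine ⟨fun h => Equiv.ext fun x => ?_, by rintro rfl; simp⟩
    by_cases hx : (x : ℕ) = 0
    · by_contra hc
      have h1 : ((σ x : Fin k) : ℕ) ≠ 0 := fun h0 => hc (Fin.ext (by simp [h0, hx]))
      exact hc (σ.injective (h _ h1))
    · exact h x hx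
  have hhigh0 : permsOn (high k k) = {1} := by
    ext σ; simp [mem_permsOn, high, Equiv.ext_iff]
  have hhigh1 : permsOn (high k (k - 1)) = {1} := by
    ext σ
    simp only [mem_permsOn, high, Finset.mem_filter, Finset.mem_univ, true_and,
      Finset.mem_singleton]
    refine ⟨fun h => Equiv.ext fun x => ?_, by rintro rfl; simp⟩
    by_cases hx : k - 1 ≤ (x : ℕ)
    · by_contra hc
      have h1 : ¬ k - 1 ≤ ((σ x : Fin k) : ℕ) := fun h0 => hc (Fin.ext (by
        have := x.2; have := (σ x).2; simp; omega))
      exact hc (σ.injective (h _ h1))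
    · exact h x hx
  by_cases hi0 : i = 0
  · subst hi0
    simp only [Nat.cast_zero, zero_smul, zero_add, Nat.sub_zero, hX, hlow0,
      hlow1]
  by_cases hik : i = k
  · subst hik
    simp only [Nat.sub_self, Nat.cast_zero, zero_smul, add_zero, hX, hhigh0, hhigh1]
  have hlt : i < k := lt_of_le_of_ne hi hik
  let e : Fin k := ⟨i - 1, by omega⟩
  let a : Fin k := ⟨i, hlt⟩
  have hae : a ≠ e := by intro h; have := congrArg Fin.val h; simp [a, e] at this; omega
  have hL : low k (i + 1) = insert a (low k i) := by
    ext x; simp [low, a, Fin.ext_iff]; omega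
  have hH : high k (i - 1) = insert e (high k i) := by
    ext x; simp [high, e, Fin.ext_iff]; omega
  have heL : e ∈ low k i := by simp [low, e]; omega
  have haL : a ∉ low k i := by simp [low, a]
  have haH : a ∈ high k i := by simp [high, a]
  have heH : e ∉ high k i := by simp [high, e]; omega
  set Y := ∑ τ ∈ permsOn (high k i), ∑ h ∈ permsOn (low k i),
    ((Perm.sign τ : ℤ) : ℂ) • F (τ * (swap a e * h)) with hY
  have hsq : ∀ σ : Perm (Fin k), ((Perm.sign σ : ℤ) : ℂ) * ((Perm.sign σ : ℤ) : ℂ) = 1 := by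
    intro σ; rw [← Int.cast_mul, ← Units.val_mul, Int.units_mul_self]; simp
  have h1 : ∑ τ ∈ permsOn (high k i), ∑ h ∈ permsOn (low k (i + 1)),
      ((Perm.sign τ : ℤ) : ℂ) • F (τ * h) = X + (i : ℂ) • Y := by
    rw [hL, hF.sum_insert (hconvL i) (disjoint_low_high k i) haL heL, card_low hi]
  have h2 : ∑ τ ∈ permsOn (high k (i - 1)), ∑ h ∈ permsOn (low k i),
      ((Perm.sign τ : ℤ) : ℂ) • F (τ * h) = X - ((k - i : ℕ) : ℂ) • Y := by
    have h := hF.twist.sum_insert (hconvH i) (disjoint_low_high k i).symm heH haH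
      (fun τ => ((Perm.sign τ : ℤ) : ℂ))
    rw [← hH, card_high hi] at h
    simp only [smul_smul, Perm.sign_mul, Perm.sign_swap hae.symm, Units.val_mul, Int.cast_mul,
      ← mul_assoc, hsq, one_mul, mul_inv_rev, swap_inv] at h
    simp only [Units.val_neg, Units.val_one, Int.cast_neg, Int.cast_one, neg_mul,
      one_mul, neg_smul] at h
    have conv : ∀ (S T : Finset (Fin k)) (w : Perm (Fin k)),
        ∑ τ ∈ permsOn T, ∑ h ∈ permsOn S, ((Perm.sign h : ℤ) : ℂ) • F (h⁻¹ * (w * τ⁻¹)) =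
        ∑ h ∈ permsOn S, ∑ τ ∈ permsOn T, ((Perm.sign h : ℤ) : ℂ) • F (h * (w * τ)) := by
      intro S T w
      rw [sum_permsOn_inv T fun τ => ∑ h ∈ permsOn S,
        ((Perm.sign h : ℤ) : ℂ) • F (h⁻¹ * (w * τ)), Finset.sum_comm,
        ← sum_permsOn_inv S]
      simp
    have c1 := conv (high k (i - 1)) (low k i) 1
    have c2 := conv (high k i) (low k i) 1
    have c3 := conv (high k i) (low k i) (swap e a)
    simp only [one_mul] at c1 c2
    simp only [mul_assoc, Finset.sum_neg_distrib, smul_neg] at h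
    rw [c1, c2, c3, swap_comm e a] at h
    rw [h, hX, hY, sub_eq_add_neg]
  simp only [Nat.add_sub_cancel]
  rw [h1, h2, smul_sub, smul_add, smul_smul, smul_smul]
  have hki : ((k - i : ℕ) : ℂ) = k - i := by push_cast [hi]; ring
  rw [hki]
  module

theorem IsManin.sum_high_low {F : Perm (Fin k) → A} (hF : IsManin F) (hk : k ≠ 0) :
    ∑ i ∈ Finset.range (k + 1),
      ((-1 : ℂ) ^ i * ((i.factorial : ℂ) * ((k - i).factorial : ℂ))⁻¹) •
        ∑ τ ∈ permsOn (high k i), ∑ h ∈ permsOn (low k i),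
          ((Perm.sign h : ℤ) : ℂ) • F (τ * h) = 0 := by
  have hsq : ∀ σ : Perm (Fin k), ((Perm.sign σ : ℤ) : ℂ) * ((Perm.sign σ : ℤ) : ℂ) = 1 := by
    intro σ; rw [← Int.cast_mul, ← Units.val_mul, Int.units_mul_self]; simp
  have h := congrArg (fun z => (-1 : ℂ) ^ k • z) (hF.twist.sum_low_high hk)
  simp only [smul_zero, Finset.smul_sum, smul_smul] at h
  rw [← h]
  refine Finset.sum_congr rfl fun i hi => ?_
  have hi' : i ≤ k := by simpa [Nat.lt_succ_iff] using hi
  have hpow : (-1 : ℂ) ^ k * (-1 : ℂ) ^ (k - i) = (-1 : ℂ) ^ i := by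
    obtain ⟨j, rfl⟩ := Nat.exists_eq_add_of_le hi'
    rw [Nat.add_sub_cancel_left, pow_add, mul_assoc, ← mul_pow]; simp
  simp only [Finset.smul_sum, smul_smul]
  rw [← sum_permsOn_inv (high k i)]
  refine Finset.sum_congr rfl fun τ hτ => ?_
  rw [← sum_permsOn_inv (low k i)]
  refine Finset.sum_congr rfl fun σ hσ => ?_
  rw [commute_of_mem_permsOn (disjoint_low_high k i).symm (inv_mem_permsOn hτ)
    (inv_mem_permsOn hσ), ← mul_inv_rev, Perm.sign_inv, Perm.sign_mul]
  congr 1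
  rw [Units.val_mul, Int.cast_mul]
  simp only [← hpow]
  linear_combination (-(-1 : ℂ) ^ k * (-1 : ℂ) ^ (k - i) * ((i.factorial : ℂ) * ((k - i).factorial : ℂ))⁻¹ * ((Perm.sign σ : ℤ) : ℂ)) * hsq τ

end Master

section Koszul
open Equiv

theorem sum_eq_add_of_pair {α M : Type*} [Fintype α] [DecidableEq α] [AddCommGroup M]
    {p q : α} (hpq : p ≠ q) {f g : α → M} {δ : M} (h : ∀ w, w ≠ p → w ≠ q → f w = g w)
    (hδ : f p + f q = g p + g q + δ) : ∑ w, f w = ∑ w, g w + δ := by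
  have split : ∀ f : α → M,
      ∑ w, f w = f p + f q + ∑ w ∈ (Finset.univ.erase p).erase q, f w := fun f => by
    rw [← Finset.add_sum_erase _ _ (Finset.mem_univ p),
      ← Finset.add_sum_erase _ _ (Finset.mem_erase.2 ⟨hpq.symm, Finset.mem_univ q⟩), add_assoc]
  rw [split f, split g, hδ]
  have : ∑ w ∈ (Finset.univ.erase p).erase q, f w = ∑ w ∈ (Finset.univ.erase p).erase q, g w :=
    Finset.sum_congr rfl fun w hw => by
      simp only [Finset.mem_erase, Finset.mem_univ, and_true] at hw
      exact h w hw.2 hw.1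
  rw [this]
  abel

variable {k : ℕ}

/-- The inversions of `σ`, weighted by the parities `x`. -/
def inversionSum (σ : Perm (Fin k)) (x : Fin k → ZMod 2) : ZMod 2 :=
  ∑ p : Fin k × Fin k, if p.1 < p.2 ∧ σ p.2 < σ p.1 then x (σ p.1) * x (σ p.2) else 0

def partialSum (x : Fin k → ZMod 2) (w : Fin k) : ZMod 2 :=
  ∑ v ∈ Finset.univ.filter (fun v => v < w), x v

/-- The sign exponent of the `(s, t)` entry of a descending product of one-site operators, where
`y`, `x` are the parities of `s`, `t`. -/
def crossSum (y x : Fin k → ZMod 2) : ZMod 2 := ∑ w, (y w + x w) * partialSum x w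

/-- The sign exponent of the term of the supertrace indexed by a word with parities `x`. -/
def koszul (σ : Perm (Fin k)) (x : Fin k → ZMod 2) : ZMod 2 :=
  ∑ v, x v + inversionSum σ x + crossSum (fun v => x (σ v)) x

theorem partialSum_succ (x : Fin k → ZMod 2) {p q : Fin k} (h : (p : ℕ) + 1 = q) :
    partialSum x q = partialSum x p + x p := by
  have : Finset.univ.filter (fun v => v < q) =
      insert p (Finset.univ.filter (fun v => v < p)) := by
    ext v
    simp only [Finset.mem_filter, Finset.mem_univ, true_and, Finset.mem_insert, Fin.lt_def,
      Fin.ext_iff]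
    omega
  rw [partialSum, this, Finset.sum_insert (by simp), add_comm, partialSum]

theorem partialSum_swap (x : Fin k → ZMod 2) {p q : Fin k} (h : (p : ℕ) + 1 = q) {w : Fin k}
    (hw : w ≠ q) : partialSum (fun v => x (swap p q v)) w = partialSum x w := by
  have hne : p ≠ q := by rintro rfl; omega
  by_cases hlt : q < w
  · refine Finset.sum_equiv (swap p q) (fun v => ?_) fun _ _ => rfl
    simp only [Finset.mem_filter, Finset.mem_univ, true_and]
    by_cases h1 : v = p
    · subst h1; simp only [swap_apply_left, Fin.lt_def] at *; omega
    by_cases h2 : v = q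
    · subst h2; simp only [swap_apply_right, Fin.lt_def] at *; omega
    rw [swap_apply_of_ne_of_ne h1 h2]
  · refine Finset.sum_congr rfl fun v hv => ?_
    simp only [Finset.mem_filter, Finset.mem_univ, true_and] at hv
    have hwq : (w : ℕ) ≠ q := fun h => hw (Fin.ext h)
    beta_reduce
    rw [swap_apply_of_ne_of_ne] <;> rintro rfl <;> simp only [Fin.lt_def] at * <;> omega

theorem inversionSum_mul_swap (σ : Perm (Fin k)) (x : Fin k → ZMod 2) {p q : Fin k}
    (h : (p : ℕ) + 1 = q) :
    inversionSum (σ * swap p q) x = inversionSum σ x + x (σ p) * x (σ q) := by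
  have hne : p ≠ q := by rintro rfl; omega
  have hre : inversionSum (σ * swap p q) x = ∑ r : Fin k × Fin k,
      if swap p q r.1 < swap p q r.2 ∧ σ r.2 < σ r.1 then x (σ r.1) * x (σ r.2) else 0 := by
    refine Fintype.sum_equiv ((swap p q).prodCongr (swap p q)) _ _ fun r => ?_
    simp only [Equiv.prodCongr_apply, Prod.map_fst, Prod.map_snd, swap_apply_self, Perm.mul_apply]
    congr
  rw [hre, inversionSum]
  refine sum_eq_add_of_pair (p := (p, q)) (q := (q, p)) (by simp [hne]) ?_ ?_
  · rintro ⟨a, b⟩ h1 h2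
    have : swap p q a < swap p q b ↔ a < b := by
      simp only [ne_eq, Prod.mk.injEq] at h1 h2
      simp only [swap_apply_def, Fin.lt_def]
      simp only [Fin.ext_iff] at *
      split_ifs <;> omega
    simp only [this]
  · have hlt : p < q := Fin.lt_def.2 (by omega)
    have hne' : σ p ≠ σ q := fun h => hne (σ.injective h)
    have h2 : ∀ z : ZMod 2, z + z = 0 := by decide
    rcases lt_or_gt_of_ne hne' with h' | h' <;>
      simp [hlt, hlt.not_gt, h', h'.not_gt, mul_comm (x (σ q)), h2]

theorem inversionSum_swap_mul (σ : Perm (Fin k)) (x : Fin k → ZMod 2) {p q : Fin k}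
    (h : (p : ℕ) + 1 = q) :
    inversionSum (swap p q * σ) (fun v => x (swap p q v)) = inversionSum σ x + x p * x q := by
  have hne : p ≠ q := by rintro rfl; omega
  refine sum_eq_add_of_pair (p := (σ.symm p, σ.symm q)) (q := (σ.symm q, σ.symm p))
    (by simp [hne]) ?_ ?_
  · rintro ⟨a, b⟩ h1 h2
    have : swap p q (σ b) < swap p q (σ a) ↔ σ b < σ a := by
      simp only [ne_eq, Prod.mk.injEq, Equiv.eq_symm_apply] at h1 h2
      simp only [swap_apply_def, Fin.lt_def]
      simp only [Fin.ext_iff] at *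
      split_ifs <;> omega
    simp [this]
  · have hlt : p < q := Fin.lt_def.2 (by omega)
    have hne' : σ.symm p ≠ σ.symm q := fun h => hne (σ.symm.injective h)
    have h2 : ∀ z : ZMod 2, z + z = 0 := by decide
    rcases lt_or_gt_of_ne hne' with h' | h' <;>
      simp [hlt, hlt.not_gt, h', h'.not_gt, mul_comm (x q), h2]

theorem crossSum_swap_left (y x : Fin k → ZMod 2) {p q : Fin k} (h : (p : ℕ) + 1 = q) :
    crossSum (fun v => y (swap p q v)) x = crossSum y x + x p * (y p + y q) := by
  have hne : p ≠ q := by rintro rfl; omega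
  refine sum_eq_add_of_pair hne (fun w hp hq => by
    beta_reduce; rw [swap_apply_of_ne_of_ne hp hq]) ?_
  beta_reduce
  rw [swap_apply_left, swap_apply_right, partialSum_succ x h]
  generalize partialSum x p = S
  generalize x p = a; generalize x q = b; generalize y p = c; generalize y q = d
  revert S a b c d; decide

theorem crossSum_swap_right (y x : Fin k → ZMod 2) {p q : Fin k} (h : (p : ℕ) + 1 = q) :
    crossSum y (fun v => x (swap p q v)) = crossSum y x + (x p + x q) * y q := by
  have hne : p ≠ q := by rintro rfl; omega
  refine sum_eq_add_of_pair hne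
    (fun w hp hq => by beta_reduce; rw [swap_apply_of_ne_of_ne hp hq, partialSum_swap x h hq]) ?_
  beta_reduce
  rw [swap_apply_left, swap_apply_right, partialSum_succ x h,
    partialSum_succ (fun v => x (swap p q v)) h, partialSum_swap x h hne, swap_apply_left]
  generalize partialSum x p = S
  generalize x p = a; generalize x q = b; generalize y p = c; generalize y q = d
  revert S a b c d; decide

theorem koszul_mul_swap (σ : Perm (Fin k)) (x : Fin k → ZMod 2) {p q : Fin k}
    (h : (p : ℕ) + 1 = q) :
    koszul (σ * swap p q) x =
      koszul σ x + (x (σ p) * x (σ q) + x p * (x (σ p) + x (σ q))) := by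
  have h1 := crossSum_swap_left (fun v => x (σ v)) x h
  simp only [koszul, inversionSum_mul_swap σ x h, Perm.mul_apply, h1]
  ring

theorem koszul_swap_mul (σ : Perm (Fin k)) (x : Fin k → ZMod 2) {p q : Fin k}
    (h : (p : ℕ) + 1 = q) :
    koszul (swap p q * σ) (fun v => x (swap p q v)) =
      koszul σ x + (x p * x q + (x p + x q) * x (σ q)) := by
  have h1 := crossSum_swap_right (fun v => x (σ v)) x h
  have h2 : ∑ v, x (swap p q v) = ∑ v, x v := Equiv.sum_comp (swap p q) x
  simp only [koszul, inversionSum_swap_mul σ x h, Perm.mul_apply, swap_apply_self, h1, h2]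
  ring

/-- Induction on the length of a permutation. -/
theorem perm_induction_adj {P : Perm (Fin k) → Prop} (one : P 1)
    (mul : ∀ (p q : Fin k), (p : ℕ) + 1 = q → ∀ σ, P σ → P (σ * swap p q)) (σ : Perm (Fin k)) :
    P σ := by
  rcases k with _ | k
  · rwa [Subsingleton.elim σ 1]
  have hσ : σ ∈ Submonoid.closure
      (Set.range fun i : Fin k => swap i.castSucc i.succ) := by
    rw [Equiv.Perm.mclosure_swap_castSucc_succ]; trivial
  induction hσ using Submonoid.closure_induction_right with
  | one => exact one
  | mul_right a ha b hb ih =>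
    obtain ⟨i, rfl⟩ := hb
    exact mul _ _ (by simp) _ ih

def signBit (σ : Perm (Fin k)) : ZMod 2 := if Perm.sign σ = 1 then 0 else 1

theorem signBit_mul_swap (σ : Perm (Fin k)) {p q : Fin k} (h : p ≠ q) :
    signBit (σ * swap p q) = signBit σ + 1 := by
  rw [signBit, signBit, Perm.sign_mul, Perm.sign_swap h]
  rcases Int.units_eq_one_or (Perm.sign σ) with h | h <;> rw [h] <;> decide

/-- Exchanging the two parities of `C^{m|n}` turns the sign of a permutation into that of its
inverse, up to `sgn`. -/
theorem koszul_inv (σ : Perm (Fin k)) (x : Fin k → ZMod 2) :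
    koszul σ x + ∑ v, (x (σ v) * x v + x (σ v)) =
      koszul σ⁻¹ (fun v => 1 + x (σ v)) + (k : ZMod 2) + signBit σ := by
  induction σ using perm_induction_adj with
  | one =>
    have hinv : ∀ z : Fin k → ZMod 2, inversionSum 1 z = 0 := fun z => by
      refine Finset.sum_eq_zero fun p _ => if_neg ?_
      rintro ⟨h1, h2⟩
      exact lt_asymm h1 h2
    have hcross : ∀ z : Fin k → ZMod 2, crossSum z z = 0 := fun z => by
      refine Finset.sum_eq_zero fun p _ => ?_
      generalize z p = a; generalize partialSum z p = b
      revert a b; decide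
    have hsq : ∀ z : ZMod 2, z * z + z = 0 := by decide
    have h2 : ∀ z : ZMod 2, z + z = 0 := by decide
    simp only [koszul, inv_one, hinv, Perm.one_apply, hcross, hsq, Finset.sum_const_zero, signBit,
      Perm.sign_one, if_true, add_zero, Finset.sum_add_distrib, Finset.sum_const,
      Finset.card_univ, Fintype.card_fin, nsmul_eq_mul, mul_one]
    rw [add_comm (k : ZMod 2), add_assoc, h2, add_zero]
  | mul p q h σ ih =>
    have hne : p ≠ q := by rintro rfl; omega
    have h1 := koszul_mul_swap σ x h
    have h2 := koszul_swap_mul σ⁻¹ (fun v => 1 + x (σ v)) h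
    have h3 : ∑ v, (x ((σ * swap p q) v) * x v + x ((σ * swap p q) v)) =
        ∑ v, (x (σ v) * x v + x (σ v)) +
          (x (σ p) * x p + x (σ q) * x q + x (σ q) * x p + x (σ p) * x q) := by
      refine sum_eq_add_of_pair hne
        (fun w hp hq => by rw [Perm.mul_apply, swap_apply_of_ne_of_ne hp hq]) ?_
      simp only [Perm.mul_apply, swap_apply_left, swap_apply_right]
      generalize x p = a; generalize x q = b; generalize x (σ p) = c; generalize x (σ q) = d
      revert a b c d; decide
    rw [h1, h3, mul_inv_rev, swap_inv, signBit_mul_swap σ hne]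
    have hσ : ∀ v, σ (σ⁻¹ v) = v := σ.apply_symm_apply
    simp only [Perm.mul_apply, hσ] at h2 ⊢
    rw [h2]
    generalize koszul σ x = A at *
    generalize koszul σ⁻¹ (fun v => 1 + x (σ v)) = B at *
    generalize ∑ v, (x (σ v) * x v + x (σ v)) = C at *
    generalize signBit σ = D at *
    generalize (k : ZMod 2) = E at *
    generalize x p = a; generalize x q = b; generalize x (σ p) = c; generalize x (σ q) = d
    clear h1 h2 h3
    revert A B C D E
    suffices h : ∀ a b c d : ZMod 2, (c * d + a * (c + d)) + (c * a + d * b + d * a + c * b) =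
        ((1 + c) * (1 + d) + (1 + c + (1 + d)) * (1 + b)) + 1 by
      intro A B C D E hh
      linear_combination hh + h a b c d
    decide

end Koszul

section Shift
open PowerSeries

/-- The expansion of `(u - z)⁻¹` in powers of `u⁻¹`. -/
def shiftVar (z : ℂ) : ℂ⟦X⟧ := X * rescale z (mk 1)

theorem coeff_shiftVar_pow_of_lt (z : ℂ) {p s : ℕ} (h : p < s) : coeff p (shiftVar z ^ s) = 0 := by
  rw [shiftVar, mul_pow, coeff_X_pow_mul', if_neg (by omega)]

theorem coeff_shiftVar_pow_mul_of_lt (z w : ℂ) {p r s : ℕ} (h : p < r + s) :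
    coeff p (shiftVar z ^ r * shiftVar w ^ s) = 0 := by
  have : shiftVar z ^ r * shiftVar w ^ s =
      X ^ (r + s) * (rescale z (mk 1) ^ r * rescale w (mk 1) ^ s) := by
    rw [shiftVar, shiftVar, mul_pow, mul_pow, pow_add]; ring
  rw [this, coeff_X_pow_mul', if_neg (by omega)]

theorem coeff_shiftVar_pow (z : ℂ) {p s : ℕ} (h : s ≤ p) :
    coeff p (shiftVar z ^ s) = shiftCoeff z p s := by
  rw [shiftVar, mul_pow, coeff_X_pow_mul', if_pos h, ← map_pow, coeff_rescale, shiftCoeff]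
  rcases s with _ | s
  · rcases p with _ | p
    · simp
    · simp [coeff_one]
  · obtain ⟨q, rfl⟩ := Nat.exists_eq_add_of_le h
    rw [mk_one_pow_eq_mk_choose_add, coeff_mk]
    have h1 : s + 1 + q - (s + 1) = q := by omega
    have h2 : s + 1 + q - 1 = s + q := by omega
    rw [h1, h2, Nat.choose_symm_add, mul_comm]

theorem shiftVar_mul_sub (z : ℂ) : shiftVar z * (1 - C z * X) = X := by
  have h := congrArg (rescale z) (mk_one_mul_one_sub_eq_one ℂ)
  rw [map_mul, map_sub, map_one, rescale_X] at h
  rw [shiftVar, mul_assoc, h, mul_one]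

theorem one_sub_ne_zero (z : ℂ) : (1 - C z * X : ℂ⟦X⟧) ≠ 0 := by
  intro h
  simpa using congrArg (coeff 0) h

theorem shiftVar_sub (z : ℂ) :
    shiftVar (z + 1) - shiftVar z = shiftVar z * shiftVar (z + 1) := by
  have h1 := shiftVar_mul_sub z
  have h2 := shiftVar_mul_sub (z + 1)
  refine mul_right_cancel₀ (one_sub_ne_zero z) (mul_right_cancel₀ (one_sub_ne_zero (z + 1)) ?_)
  have hC : (C (z + 1) : ℂ⟦X⟧) = C z + 1 := by simp
  rw [hC] at h2 ⊢
  linear_combination (1 - C z * X) * h2 - (1 - (C z + 1) * X) * h1 -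
    (shiftVar (z+1) * (1 - (C z + 1) * X)) * h1 - X * h2

variable {R : Type} [Ring R] [Algebra ℂ R]

theorem serShiftS_eq (z : ℂ) (F : ℕ → R) {p M : ℕ} (h : p ≤ M) :
    serShiftS z F p = ∑ s ∈ Finset.range (M + 1), coeff p (shiftVar z ^ s) • F s := by
  rw [serShiftS]
  refine Finset.sum_subset_zero_on_sdiff (Finset.range_mono (by omega)) ?_ ?_
  · intro s hs
    simp only [Finset.mem_sdiff, Finset.mem_range] at hs
    rw [coeff_shiftVar_pow_of_lt z (by omega), zero_smul]
  · intro s hs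
    rw [coeff_shiftVar_pow z (by simpa [Nat.lt_succ_iff] using hs)]

theorem coeff_mk_shift_mul (z w : ℂ) (F G : ℕ → R) (p : ℕ) :
    coeff p (mk (serShiftS z F) * mk (serShiftS w G)) =
      ∑ r ∈ Finset.range (p + 1), ∑ s ∈ Finset.range (p + 1),
        coeff p (shiftVar z ^ r * shiftVar w ^ s) • (F r * G s) := by
  rw [coeff_mul]
  have : ∀ x ∈ Finset.HasAntidiagonal.antidiagonal p, coeff x.1 (mk (serShiftS z F)) *
      coeff x.2 (mk (serShiftS w G)) = ∑ r ∈ Finset.range (p + 1), ∑ s ∈ Finset.range (p + 1),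
        (coeff x.1 (shiftVar z ^ r) * coeff x.2 (shiftVar w ^ s)) • (F r * G s) := by
    intro x hx
    rw [Finset.HasAntidiagonal.mem_antidiagonal] at hx
    rw [coeff_mk, coeff_mk, serShiftS_eq z F (M := p) (by omega),
      serShiftS_eq w G (M := p) (by omega), Finset.sum_mul_sum]
    simp only [smul_mul_smul_comm]
  rw [Finset.sum_congr rfl this, Finset.sum_comm]
  refine Finset.sum_congr rfl fun r _ => ?_
  rw [Finset.sum_comm]
  refine Finset.sum_congr rfl fun s _ => ?_
  rw [← Finset.sum_smul, coeff_mul]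

theorem sum_range_antidiagonal_eq {M : Type*} [AddCommMonoid M] (p : ℕ) (h : ℕ → ℕ → M)
    (h0 : ∀ r s, p < r + s → h r s = 0) :
    ∑ s ∈ Finset.range (p + 1), ∑ x ∈ Finset.HasAntidiagonal.antidiagonal s, h x.1 x.2 =
      ∑ r ∈ Finset.range (p + 1), ∑ s ∈ Finset.range (p + 1), h r s := by
  rw [← Finset.sum_product', ← Finset.sum_filter_add_sum_filter_not _
    (fun x : ℕ × ℕ => x.1 + x.2 ∈ Finset.range (p + 1))]
  have hz : ∑ x ∈ (Finset.range (p + 1) ×ˢ Finset.range (p + 1)).filter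
      (fun x : ℕ × ℕ => x.1 + x.2 ∉ Finset.range (p + 1)), h x.1 x.2 = 0 := by
    refine Finset.sum_eq_zero fun x hx => ?_
    simp only [Finset.mem_filter, Finset.mem_range] at hx
    exact h0 _ _ (by omega)
  rw [hz, add_zero, ← Finset.sum_fiberwise_of_maps_to (t := Finset.range (p + 1))
    (g := fun x : ℕ × ℕ => x.1 + x.2) (fun x hx => (Finset.mem_filter.1 hx).2)]
  refine Finset.sum_congr rfl fun s hs => Finset.sum_congr ?_ fun _ _ => rfl
  ext ⟨a, b⟩
  simp only [Finset.HasAntidiagonal.mem_antidiagonal, Finset.mem_filter, Finset.mem_product,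
    Finset.mem_range] at *
  omega

/-- The shift `F(u) ↦ F(u - z)` of power series in `u⁻¹`. -/
def shiftHom (z : ℂ) : R⟦X⟧ →ₐ[ℂ] R⟦X⟧ :=
  AlgHom.ofLinearMap
    { toFun := fun F => mk (serShiftS z fun p => coeff p F)
      map_add' := fun F G => by
        ext p
        simp [serShiftS, smul_add, Finset.sum_add_distrib]
      map_smul' := fun c F => by
        ext p
        simp [serShiftS, Finset.smul_sum, smul_comm c] }
    (by
      ext p
      simp only [LinearMap.coe_mk, AddHom.coe_mk, coeff_mk, coeff_one, serShiftS_eq z _ le_rfl]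
      rw [Finset.sum_eq_single 0 (fun s _ hs => by simp [hs]) (by simp)]
      simp [coeff_one])
    (fun F G => by
      ext p
      simp only [LinearMap.coe_mk, AddHom.coe_mk]
      rw [coeff_mk_shift_mul, coeff_mk, serShiftS_eq z _ le_rfl]
      simp only [← pow_add]
      rw [← sum_range_antidiagonal_eq p
        (fun r s => coeff p (shiftVar z ^ (r + s)) • (coeff r F * coeff s G))
        (fun r s h => by rw [coeff_shiftVar_pow_of_lt z h, zero_smul])]
      refine Finset.sum_congr rfl fun s _ => ?_
      rw [coeff_mul, Finset.smul_sum]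
      exact Finset.sum_congr rfl fun x hx => by rw [Finset.HasAntidiagonal.mem_antidiagonal.1 hx])

theorem coeff_shiftHom (z : ℂ) (F : R⟦X⟧) (p : ℕ) :
    coeff p (shiftHom z F) = serShiftS z (fun p => coeff p F) p := by
  simp [shiftHom]

theorem shiftHom_mk (z : ℂ) (F : ℕ → R) : shiftHom z (mk F) = mk (serShiftS z F) := by
  ext p
  simp [coeff_shiftHom]

theorem shiftHom_shiftVar (z w : ℂ) : shiftHom z (shiftVar w) = shiftVar (z + w) := by
  have hX : shiftHom z (X : ℂ⟦X⟧) = shiftVar z := by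
    ext p
    rw [coeff_shiftHom, serShiftS_eq z _ (Nat.le_succ p),
      Finset.sum_eq_single 1 (fun s _ hs => by simp [coeff_X, hs]) (by simp)]
    simp
  have h := congrArg (shiftHom z) (shiftVar_mul_sub w)
  have hC : ∀ c : ℂ, (C c : ℂ⟦X⟧) = algebraMap ℂ _ c := fun c => by
    rw [PowerSeries.algebraMap_apply]; rfl
  rw [map_mul, map_sub, map_one, map_mul, hX, hC, AlgHom.commutes, ← hC] at h
  have h1 := shiftVar_mul_sub z
  refine mul_right_cancel₀ (one_sub_ne_zero (z + w)) ?_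
  rw [shiftVar_mul_sub, map_add]
  linear_combination (1 - C z * X) * h + (1 + C w * shiftHom z (shiftVar w)) * h1

theorem shiftHom_shiftHom (z w : ℂ) (F : R⟦X⟧) :
    shiftHom z (shiftHom w F) = shiftHom (z + w) F := by
  ext p
  rw [coeff_shiftHom, coeff_shiftHom, serShiftS_eq z _ le_rfl, serShiftS_eq (z + w) _ le_rfl]
  have h1 : ∀ s ∈ Finset.range (p + 1), coeff p (shiftVar z ^ s) • coeff s (shiftHom w F) =
      ∑ t ∈ Finset.range (p + 1),
        (coeff p (shiftVar z ^ s) * coeff s (shiftVar w ^ t)) • coeff t F := by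
    intro s hs
    rw [coeff_shiftHom, serShiftS_eq w _ (Nat.lt_succ_iff.1 (Finset.mem_range.1 hs)),
      Finset.smul_sum]
    simp only [smul_smul]
  rw [Finset.sum_congr rfl h1, Finset.sum_comm]
  refine Finset.sum_congr rfl fun t _ => ?_
  rw [← Finset.sum_smul, ← shiftHom_shiftVar, ← map_pow, coeff_shiftHom, serShiftS_eq z _ le_rfl]
  rfl

theorem sum_range_succ_shift {M : Type*} [AddCommGroup M] {p : ℕ} {f : ℕ → M} (h0 : f 0 = 0) :
    ∑ s ∈ Finset.range (p + 1), f s + f (p + 1) = ∑ s ∈ Finset.range (p + 1), f (s + 1) := by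
  rw [← Finset.sum_range_succ, Finset.sum_range_succ', h0, add_zero]

/-- The specialization `v = u - 1` of a relation `(u - v) C(u, v) = D(u, v)`. -/
theorem specialize_diff (z : ℂ) {C D : ℕ → ℕ → R} (hrel : ∀ r s, C (r + 1) s - C r (s + 1) = D r s)
    (hr : ∀ s, C 0 s = 0) (hs : ∀ r, C r 0 = 0) (p : ℕ) :
    ∑ r ∈ Finset.range (p + 1), ∑ s ∈ Finset.range (p + 1),
        coeff p (shiftVar z ^ r * shiftVar (z + 1) ^ s) • C r s =
      ∑ r ∈ Finset.range (p + 1), ∑ s ∈ Finset.range (p + 1),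
        coeff p (shiftVar z ^ r * shiftVar (z + 1) ^ s) • D r s := by
  have hz : ∀ r s, p < r + s → coeff p (shiftVar z ^ r * shiftVar (z + 1) ^ s) = 0 :=
    fun r s h => coeff_shiftVar_pow_mul_of_lt z (z + 1) h
  have e1 : ∑ r ∈ Finset.range (p + 1), ∑ s ∈ Finset.range (p + 1),
      coeff p (shiftVar z ^ r * shiftVar (z + 1) ^ s) • C (r + 1) s =
      ∑ r ∈ Finset.range (p + 1), ∑ s ∈ Finset.range (p + 1),
      coeff p (shiftVar z ^ r * shiftVar (z + 1) ^ (s + 1)) • C (r + 1) (s + 1) := by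
    refine Finset.sum_congr rfl fun r _ => ?_
    rw [← sum_range_succ_shift (f := fun s =>
      coeff p (shiftVar z ^ r * shiftVar (z + 1) ^ s) • C (r + 1) s) (by simp [hs]),
      hz r (p + 1) (by omega), zero_smul, add_zero]
  have e2 : ∑ r ∈ Finset.range (p + 1), ∑ s ∈ Finset.range (p + 1),
      coeff p (shiftVar z ^ r * shiftVar (z + 1) ^ s) • C r (s + 1) =
      ∑ r ∈ Finset.range (p + 1), ∑ s ∈ Finset.range (p + 1),
      coeff p (shiftVar z ^ (r + 1) * shiftVar (z + 1) ^ s) • C (r + 1) (s + 1) := by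
    rw [Finset.sum_comm, Finset.sum_comm (s := Finset.range (p + 1)) (t := Finset.range (p + 1))
      (f := fun r s => coeff p (shiftVar z ^ (r + 1) * shiftVar (z + 1) ^ s) • C (r + 1) (s + 1))]
    refine Finset.sum_congr rfl fun s _ => ?_
    rw [← sum_range_succ_shift (f := fun r =>
      coeff p (shiftVar z ^ r * shiftVar (z + 1) ^ s) • C r (s + 1)) (by simp [hr]),
      hz (p + 1) s (by omega), zero_smul, add_zero]
  have e3 : ∑ r ∈ Finset.range (p + 1), ∑ s ∈ Finset.range (p + 1),
      coeff p (shiftVar z ^ r * shiftVar (z + 1) ^ s) • C r s =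
      ∑ r ∈ Finset.range (p + 1), ∑ s ∈ Finset.range (p + 1),
      coeff p (shiftVar z ^ (r + 1) * shiftVar (z + 1) ^ (s + 1)) • C (r + 1) (s + 1) := by
    have h0 : ∑ s ∈ Finset.range (p + 1),
        coeff p (shiftVar z ^ (p + 1) * shiftVar (z + 1) ^ (s + 1)) • C (p + 1) (s + 1) = 0 :=
      Finset.sum_eq_zero fun s _ => by rw [hz (p + 1) (s + 1) (by omega), zero_smul]
    rw [← sum_range_succ_shift (f := fun r => ∑ s ∈ Finset.range (p + 1),
      coeff p (shiftVar z ^ r * shiftVar (z + 1) ^ (s + 1)) • C r (s + 1)) (by simp [hr]),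
      h0, add_zero]
    refine Finset.sum_congr rfl fun r _ => ?_
    rw [← sum_range_succ_shift (f := fun s =>
      coeff p (shiftVar z ^ r * shiftVar (z + 1) ^ s) • C r s) (by simp [hs]),
      hz r (p + 1) (by omega), zero_smul, add_zero]
  simp only [← hrel, smul_sub, Finset.sum_sub_distrib]
  rw [e1, e2, e3, ← Finset.sum_sub_distrib]
  refine Finset.sum_congr rfl fun r _ => ?_
  rw [← Finset.sum_sub_distrib]
  refine Finset.sum_congr rfl fun s _ => ?_
  rw [← sub_smul, ← map_sub]
  congr 2
  linear_combination (-shiftVar z ^ r * shiftVar (z + 1) ^ s) * shiftVar_sub z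

end Shift

section Yang
open PowerSeries Equiv

/-- The sign character of `ZMod 2`. -/
def chi (e : ZMod 2) : ℂ := if e = 0 then 1 else -1

theorem chi_zero : chi 0 = 1 := by simp [chi]

theorem chi_one : chi 1 = -1 := by simp [chi]

theorem chi_add (e f : ZMod 2) : chi (e + f) = chi e * chi f := by
  have : ∀ e : ZMod 2, e = 0 ∨ e = 1 := by decide
  have h2 : (1 + 1 : ZMod 2) = 0 := by decide
  rcases this e with rfl | rfl <;> rcases this f with rfl | rfl <;> simp [chi, h2]

theorem chi_natCast (k : ℕ) : chi (k : ZMod 2) = (-1) ^ k := by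
  induction k with
  | zero => simp [chi]
  | succ k ih => rw [Nat.cast_succ, chi_add, ih, chi_one, pow_succ]

theorem chi_signBit {k : ℕ} (σ : Perm (Fin k)) : chi (signBit σ) = ((Perm.sign σ : ℤ) : ℂ) := by
  rcases Int.units_eq_one_or (Perm.sign σ) with h | h <;> simp [signBit, h, chi]

variable {m n : ℕ}

def parity (m : ℕ) {N : ℕ} (a : Fin N) : ZMod 2 := par m a

theorem TT_rel (a b c d : Fin (m + n)) (r s : ℕ) :
    (TT m n a b (r + 1) * TT m n c d s -
        chi ((parity m a + parity m b) * (parity m c + parity m d)) •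
          (TT m n c d s * TT m n a b (r + 1))) -
      (TT m n a b r * TT m n c d (s + 1) -
        chi ((parity m a + parity m b) * (parity m c + parity m d)) •
          (TT m n c d (s + 1) * TT m n a b r)) =
      chi (parity m a * parity m c + parity m a * parity m d + parity m c * parity m d) •
        (TT m n c b s * TT m n a d r - TT m n c b r * TT m n a d s) := by
  have h := RingQuot.mkAlgHom_rel ℂ (YRel.rtt (m := m) (n := n) a b c d r s)
  simp only [map_sub, map_mul, map_smul] at h
  rw [← chi_natCast, ← chi_natCast] at h
  push_cast at h
  exact h

/-- The series `T_{ab}(u - z)`. -/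
def Tser (z : ℂ) (a b : Fin (m + n)) : (Yangian m n)⟦X⟧ := mk (serShiftS z (TT m n a b))

theorem TT_zero (a b : Fin (m + n)) : TT m n a b 0 = if a = b then 1 else 0 := by
  rw [TT, Tfree]
  split_ifs <;> simp

theorem zmod_two_add_self (z : ZMod 2) : z + z = 0 := by
  revert z; decide

theorem Tser_comm (z : ℂ) (a b c d : Fin (m + n)) :
    Tser z a b * Tser (z + 1) c d -
      chi ((parity m a + parity m b) * (parity m c + parity m d)) •
        (Tser (z + 1) c d * Tser z a b) =
      chi (parity m a * parity m c + parity m a * parity m d + parity m c * parity m d) •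
        (Tser (z + 1) c b * Tser z a d - Tser z c b * Tser (z + 1) a d) := by
  have key : ∀ (a b c d : Fin (m + n)) (p : ℕ), coeff p (Tser (z + 1) c d * Tser z a b) =
      ∑ r ∈ Finset.range (p + 1), ∑ s ∈ Finset.range (p + 1),
        coeff p (shiftVar z ^ r * shiftVar (z + 1) ^ s) • (TT m n c d s * TT m n a b r) := by
    intro a b c d p
    rw [Tser, Tser, coeff_mk_shift_mul, Finset.sum_comm]
    simp only [mul_comm]
  have key' : ∀ (a b c d : Fin (m + n)) (p : ℕ), coeff p (Tser z a b * Tser (z + 1) c d) =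
      ∑ r ∈ Finset.range (p + 1), ∑ s ∈ Finset.range (p + 1),
        coeff p (shiftVar z ^ r * shiftVar (z + 1) ^ s) • (TT m n a b r * TT m n c d s) :=
    fun a b c d p => by rw [Tser, Tser, coeff_mk_shift_mul]
  have h := specialize_diff (R := Yangian m n) z
    (C := fun r s => TT m n a b r * TT m n c d s -
      chi ((parity m a + parity m b) * (parity m c + parity m d)) •
        (TT m n c d s * TT m n a b r))
    (D := fun r s =>
      chi (parity m a * parity m c + parity m a * parity m d + parity m c * parity m d) •
        (TT m n c b s * TT m n a d r - TT m n c b r * TT m n a d s))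
    (TT_rel a b c d) ?_ ?_
  · ext p
    have := h p
    simp only [map_sub, coeff_smul, key, key', Finset.smul_sum, ← Finset.sum_sub_distrib] at this ⊢
    simp only [smul_comm (chi _), smul_sub] at this ⊢
    exact this
  · intro s
    rw [TT_zero]
    split_ifs with h
    · simp [h, zmod_two_add_self, chi_zero]
    · simp
  · intro s
    rw [TT_zero]
    split_ifs with h
    · simp [h, zmod_two_add_self, chi_zero]
    · simp

/-- The four-term relation between `T_{cd}(u) T_{ab}(u - 1)` and its permutations. -/
theorem Tser_four_term (z : ℂ) (a b c d : Fin (m + n)) :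
    Tser z c d * Tser (z + 1) a b +
      chi (parity m a * parity m c + parity m a * parity m b + parity m b * parity m c) •
        (Tser z a d * Tser (z + 1) c b) =
      chi (parity m b * parity m d + parity m b * parity m c + parity m c * parity m d) •
        (Tser z c b * Tser (z + 1) a d) +
      chi (parity m a * parity m c + parity m b * parity m d + parity m a * parity m d +
        parity m b * parity m c) • (Tser z a b * Tser (z + 1) c d) := by
  have h1 := sub_eq_iff_eq_add.1 (Tser_comm z c d a b)
  have h2 := sub_eq_iff_eq_add.1 (Tser_comm z c b a d)
  generalize parity m a = a' at *
  generalize parity m b = b' at *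
  generalize parity m c = c' at *
  generalize parity m d = d' at *
  rw [h1, h2]
  have e1 : b' * d' + b' * c' + c' * d' + (c' * a' + c' * d' + a' * d') =
      a' * c' + b' * d' + a' * d' + b' * c' := by
    linear_combination zmod_two_add_self (c' * d')
  have e2 : b' * d' + b' * c' + c' * d' + (c' + b') * (a' + d') =
      c' * a' + c' * b' + a' * b' := by
    linear_combination zmod_two_add_self (c' * d') + zmod_two_add_self (b' * d')
  have e3 : (c' + d') * (a' + b') = a' * c' + b' * d' + a' * d' + b' * c' := by ring
  have e4 : a' * c' + a' * b' + b' * c' = c' * a' + c' * b' + a' * b' := by ring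
  simp only [smul_add, smul_sub, smul_smul, ← chi_add, e1, e2, e3, e4]
  abel

end Yang

section Manin
open PowerSeries Equiv

/-- The product `f (k - 1) * ⋯ * f 0`. -/
def descProd {R : Type*} [Monoid R] {k : ℕ} (f : Fin k → R) : R :=
  ((List.finRange k).reverse.map f).prod

theorem descProd_succ {R : Type*} [Monoid R] {k : ℕ} (f : Fin (k + 1) → R) :
    descProd f = f (Fin.last k) * descProd fun v : Fin k => f v.castSucc := by
  simp [descProd, List.finRange_succ_last, Function.comp_def]

theorem descProd_adj {R : Type*} [Monoid R] {k : ℕ} (f : Fin k → R) {p q : Fin k}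
    (h : (p : ℕ) + 1 = q) : ∃ L S : R, ∀ g : Fin k → R,
      (∀ w, w ≠ p → w ≠ q → g w = f w) → descProd g = L * (g q * g p) * S := by
  induction k with
  | zero => exact p.elim0
  | succ k ih =>
    induction q using Fin.lastCases with
    | last =>
      rcases k with _ | k
      · simp at h
      obtain rfl : p = (Fin.last k).castSucc := by
        ext
        simpa using h
      refine ⟨1, descProd fun v : Fin k => f v.castSucc.castSucc, fun g hg => ?_⟩
      rw [descProd_succ, descProd_succ, one_mul, mul_assoc]
      congr 3
      funext v
      refine hg _ ?_ ?_ <;> simp [Fin.ext_iff] <;> omega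
    | cast q =>
      obtain ⟨p, rfl⟩ : ∃ p' : Fin k, p = p'.castSucc :=
        ⟨⟨p, by simp at h; omega⟩, rfl⟩
      obtain ⟨L, S, hLS⟩ := ih (fun v => f v.castSucc) (p := p) (q := q) (by simpa using h)
      refine ⟨f (Fin.last k) * L, S, fun g hg => ?_⟩
      rw [descProd_succ, hLS (fun v => g v.castSucc)
        (fun w h1 h2 => hg _ (by simpa using h1) (by simpa using h2)),
        hg (Fin.last k) (Fin.castSucc_ne_last p).symm (Fin.castSucc_ne_last q).symm]
      simp only [mul_assoc]

variable {m n : ℕ}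

/-- The supertrace of `P_σ Q^{⊗k} T^{(k)}(u) ⋯ T^{(1)}(u - k + 1)` for `Q = diag d`. -/
def Phi (d : Fin (m + n) → ℂ) (k : ℕ) (σ : Perm (Fin k)) : (Yangian m n)⟦X⟧ :=
  ∑ r : Fin k → Fin (m + n), (chi (koszul σ fun v => parity m (r v)) * ∏ v, d (r v)) •
    descProd fun v => Tser ((k : ℂ) - 1 - (v : ℕ)) (r (σ v)) (r v)

theorem Phi_swap_mul (d : Fin (m + n) → ℂ) {k : ℕ} (σ : Perm (Fin k)) (p q : Fin k) :
    Phi d k (swap p q * σ) = ∑ r : Fin k → Fin (m + n),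
      (chi (koszul (swap p q * σ) fun v => parity m (r (swap p q v))) * ∏ v, d (r v)) •
        descProd fun v => Tser ((k : ℂ) - 1 - (v : ℕ)) (r (σ v)) (r (swap p q v)) := by
  refine Fintype.sum_equiv ((swap p q).arrowCongr (Equiv.refl _)) _ _ fun r => ?_
  simp only [arrowCongr_apply, Equiv.coe_refl, id_eq, Function.comp_apply, symm_swap,
    swap_apply_self, Perm.mul_apply]
  rw [Equiv.prod_comp (swap p q) (fun v => d (r v))]

theorem isManin_Phi (d : Fin (m + n) → ℂ) (k : ℕ) : IsManin (Phi d k) := by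
  intro p q h σ
  have hne : p ≠ q := by rintro rfl; omega
  rw [mul_assoc, Phi_swap_mul, Phi_swap_mul, Phi, Phi, ← Finset.sum_add_distrib,
    ← Finset.sum_add_distrib]
  refine Finset.sum_congr rfl fun r _ => ?_
  have k1 := koszul_mul_swap σ (fun v => parity m (r v)) h
  have k2 := koszul_swap_mul σ (fun v => parity m (r v)) h
  have k3 := koszul_swap_mul (σ * swap p q) (fun v => parity m (r v)) h
  simp only [Perm.mul_apply, swap_apply_right] at k1 k2 k3
  obtain ⟨L, S, hLS⟩ := descProd_adj
    (fun v : Fin k => Tser ((k : ℂ) - 1 - (v : ℕ)) (r (σ v)) (r v)) h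
  have hz : (k : ℂ) - 1 - (p : ℕ) = (k : ℂ) - 1 - (q : ℕ) + 1 := by
    rw [← h]; push_cast; ring
  rw [k3, k1, k2, hLS _ (fun _ _ _ => rfl)]
  rw [hLS _ (fun w h1 h2 => by simp [swap_apply_of_ne_of_ne h1 h2]),
    hLS _ (fun w h1 h2 => by rw [swap_apply_of_ne_of_ne h1 h2]),
    hLS _ (fun w h1 h2 => by simp [swap_apply_of_ne_of_ne h1 h2])]
  simp only [Perm.mul_apply, swap_apply_left, swap_apply_right, hz]
  have key := congrArg (fun T => (chi (koszul σ fun v => parity m (r v)) * ∏ v, d (r v)) •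
    (L * T * S)) (Tser_four_term ((k : ℂ) - 1 - (q : ℕ)) (r (σ p)) (r p) (r (σ q)) (r q))
  simp only [mul_add, add_mul, smul_add, mul_smul_comm, smul_mul_assoc, smul_smul] at key
  have e1 : ∀ a b c : ZMod 2, a * c + b * (a + c) = a * c + a * b + b * c := by decide
  have e2 : ∀ b c d : ZMod 2, b * d + (b + d) * c = b * d + b * c + c * d := by decide
  have e3 : ∀ a b c d : ZMod 2, a * c + b * (a + c) + (b * d + (b + d) * a) =
      a * c + b * d + a * d + b * c := by decide
  rw [add_assoc (koszul σ _), e3, e1, e2]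
  simp only [chi_add (koszul σ _), mul_right_comm (chi (koszul σ _)) (chi _)]
  exact key

end Manin

section Evaluation
open PowerSeries Equiv

theorem crossSum_update {k : ℕ} (y x : Fin k → ZMod 2) (v : Fin k) (h : ∀ w < v, y w = x w) :
    crossSum y (Function.update x v (y v)) + (y v + x v) * partialSum x v +
      (y v + x v) * ∑ w, (y w + Function.update x v (y v) w) = crossSum y x := by
  have h1 : (y v + x v) * partialSum x v =
      ∑ w, if w = v then (y v + x v) * partialSum x v else 0 := by simp
  rw [h1, crossSum, crossSum, Finset.mul_sum, ← Finset.sum_add_distrib, ← Finset.sum_add_distrib]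
  refine Finset.sum_congr rfl fun w _ => ?_
  rcases lt_trichotomy w v with hw | rfl | hw
  · simp [hw.ne, h w hw, zmod_two_add_self]
  · simp [zmod_two_add_self]
  · have hv : v ∈ Finset.univ.filter (fun u => u < w) := by simpa using hw
    have hp : partialSum (Function.update x v (y v)) w = partialSum x w + (y v + x v) := by
      rw [partialSum, partialSum, Finset.sum_update_of_mem hv,
        ← Finset.add_sum_erase _ x hv, Finset.sdiff_singleton_eq_erase]
      linear_combination - zmod_two_add_self (x v)
    rw [hp, Function.update_of_ne hw.ne', if_neg hw.ne']
    linear_combination zmod_two_add_self ((y v + x v) * (y w + x w))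

theorem serProd_append {R : Type} [Ring R] {N : ℕ} {ι : Type} [Fintype ι]
    [DecidableEq ι] (m : ℕ) (l : List (ℕ → Matrix (ι → Fin N) (ι → Fin N) R)) (F) :
    serProd m (l ++ [F]) = serMul m (serProd m l) F := by
  simp [serProd]

variable {R : Type} [Ring R] [Algebra ℂ R] {N : ℕ}

theorem neg_one_pow_mul (k : ℕ) (x : R) : (-1 : R) ^ k * x = chi k • x := by
  rw [chi_natCast, Algebra.smul_def]
  simp

theorem cast_par (m : ℕ) (a : Fin N) : ((par m a : ℕ) : ZMod 2) = parity m a := rfl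

theorem cast_mpar {ι : Type} [Fintype ι] [DecidableEq ι] (m : ℕ) (r : ι → Fin N) :
    ((mpar m r : ℕ) : ZMod 2) = ∑ v, parity m (r v) := by
  simp [mpar, cast_par]

theorem sMul_apply {ι : Type} [Fintype ι] [DecidableEq ι] (m : ℕ)
    (A B : Matrix (ι → Fin N) (ι → Fin N) R) (r t : ι → Fin N) :
    sMul m A B r t = ∑ s, chi ((∑ v, parity m (s v) + ∑ v, parity m (t v)) *
      (∑ v, parity m (r v) + ∑ v, parity m (s v))) • (A r s * B s t) := by
  refine Finset.sum_congr rfl fun s _ => ?_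
  rw [mul_assoc, neg_one_pow_mul]
  push_cast
  simp only [cast_mpar]

theorem embed_apply {k : ℕ} (m : ℕ) (v : Fin k) (f : Fin N → Fin N → R)
    (r s : Fin k → Fin N) : embed m (· < ·) v f r s = if ∀ w, w ≠ v → r w = s w then
      chi ((parity m (r v) + parity m (s v)) * partialSum (fun w => parity m (s w)) v) •
        f (r v) (s v) else 0 := by
  have h : ((-1 : R) ^ ((par m (r v) + par m (s v)) *
      ∑ w ∈ Finset.univ.filter (fun w => w < v), par m (s w))) * f (r v) (s v) =
      chi ((parity m (r v) + parity m (s v)) * partialSum (fun w => parity m (s w)) v) •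
        f (r v) (s v) := by
    rw [neg_one_pow_mul]
    push_cast
    rfl
  rw [embed, h]
  by_cases hw : ∀ w, w ≠ v → r w = s w
  · rw [if_pos hw, if_pos hw]
  · rw [if_neg hw, if_neg hw]

theorem serProd_apply {k : ℕ} (m : ℕ) (f : Fin k → Fin N → Fin N → R⟦X⟧) (l : List (Fin k))
    (hl : l.Pairwise (· > ·)) (p : ℕ) (r t : Fin k → Fin N) :
    serProd m (l.map fun v p => embed m (· < ·) v fun a b => coeff p (f v a b)) p r t =
      if ∀ w, w ∉ l → r w = t w then
        chi (crossSum (fun v => parity m (r v)) fun v => parity m (t v)) •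
          coeff p (l.map fun v => f v (r v) (t v)).prod
      else 0 := by
  induction l using List.reverseRecOn generalizing p t with
  | nil =>
    by_cases h : r = t
    · subst h
      have hc : (crossSum (fun v => parity m (r v)) fun v => parity m (r v)) = 0 :=
        Finset.sum_eq_zero fun w _ => by simp [zmod_two_add_self]
      by_cases hp : p = 0 <;> simp [hc, chi_zero, serProd, serOne, coeff_one, hp]
    · have h' : ¬ ∀ w, w ∉ ([] : List (Fin k)) → r w = t w :=
        fun h' => h (funext fun w => h' w (by simp))
      rw [if_neg h']
      simp only [serProd, serOne, List.map_nil, List.foldl_nil]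
      split_ifs <;> simp [h]
  | append_singleton l v ih =>
    rw [List.pairwise_append] at hl
    obtain ⟨hl, -, hv⟩ := hl
    have hv : ∀ w ∈ l, v < w := fun w hw => hv w hw v (by simp)
    have hvl : v ∉ l := fun h => lt_irrefl _ (hv v h)
    rw [List.map_append, List.map_singleton, serProd_append]
    simp only [serMul, Matrix.sum_apply, sMul_apply, ih hl, embed_apply]
    have key : ∀ q, ∑ s : Fin k → Fin N,
        chi ((∑ v, parity m (s v) + ∑ v, parity m (t v)) *
          (∑ v, parity m (r v) + ∑ v, parity m (s v))) •
        ((if ∀ w, w ∉ l → r w = s w then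
          chi (crossSum (fun v => parity m (r v)) fun v => parity m (s v)) •
            coeff q (l.map fun v => f v (r v) (s v)).prod else 0) *
        (if ∀ w, w ≠ v → s w = t w then
          chi ((parity m (s v) + parity m (t v)) * partialSum (fun w => parity m (t w)) v) •
          coeff (p - q) (f v (s v) (t v)) else 0)) =
        if ∀ w, w ∉ l ++ [v] → r w = t w then
          chi (crossSum (fun v => parity m (r v)) fun v => parity m (t v)) •
            (coeff q (l.map fun v => f v (r v) (t v)).prod *
              coeff (p - q) (f v (r v) (t v)))
        else 0 := by
      intro q
      have hs : ∀ s : Fin k → Fin N, (∀ w, w ∉ l → r w = s w) → (∀ w, w ≠ v → s w = t w) →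
          s = Function.update t v (r v) := by
        intro s h1 h2
        funext w
        by_cases hw : w = v
        · subst hw; simp [h1 w hvl]
        · simp [hw, h2 w hw]
      rw [Finset.sum_eq_single (Function.update t v (r v))]
      · have hpar : (fun w => parity m (Function.update t v (r v) w)) =
            Function.update (fun w => parity m (t w)) v (parity m (r v)) := by
          funext w
          by_cases hw : w = v
          · subst hw; simp
          · simp [hw]
        have hmap : (l.map fun w => f w (r w) (Function.update t v (r v) w)) =
            l.map fun w => f w (r w) (t w) :=
          List.map_congr_left fun w hw => by rw [Function.update_of_ne (hv w hw).ne']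
        rw [if_pos fun w hw => Function.update_of_ne hw _ _, hmap]
        by_cases h : ∀ w, w ∉ l ++ [v] → r w = t w
        · have h' : ∀ w, w ∉ l → r w = Function.update t v (r v) w := by
            intro w hw
            by_cases hwv : w = v
            · subst hwv; simp
            · rw [Function.update_of_ne hwv, h w (by simp [hw, hwv])]
          have hlt : ∀ w < v, parity m (r w) = parity m (t w) := fun w hw => by
            rw [h w (by simpa [hw.ne] using fun h => hw.not_gt (hv w h))]
          have hc := crossSum_update (fun w => parity m (r w)) (fun w => parity m (t w)) v hlt
          have hsum : ∑ w, Function.update (fun w => parity m (t w)) v (parity m (r v)) w +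
              ∑ w, parity m (t w) = parity m (r v) + parity m (t v) := by
            rw [Finset.sum_update_of_mem (Finset.mem_univ v),
              ← Finset.add_sum_erase _ _ (Finset.mem_univ v), Finset.sdiff_singleton_eq_erase]
            linear_combination zmod_two_add_self (∑ w ∈ Finset.univ.erase v, parity m (t w))
          rw [if_pos h', if_pos h, smul_mul_smul_comm, smul_smul, ← chi_add, ← chi_add,
            Function.update_self]
          have hpar' : ∑ w, parity m (Function.update t v (r v) w) =
            ∑ w, Function.update (fun w => parity m (t w)) v (parity m (r v)) w :=
            congrArg (fun g => ∑ w, g w) hpar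
          rw [hpar', hpar, hsum, ← Finset.sum_add_distrib, ← hc]
          congr 2
          ring
        · have h' : ¬ ∀ w, w ∉ l → r w = Function.update t v (r v) w := by
            refine fun h' => h fun w hw => ?_
            simp only [List.mem_append, List.mem_singleton, not_or] at hw
            rw [h' w hw.1, Function.update_of_ne hw.2]
          rw [if_neg h', if_neg h, zero_mul, smul_zero]
      · intro s _ hne
        by_cases h1 : ∀ w, w ∉ l → r w = s w
        · rw [if_neg fun h2 => hne (hs s h1 h2), mul_zero, smul_zero]
        · rw [if_neg h1, zero_mul, smul_zero]
      · simp
    simp only [key]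
    split_ifs
    · rw [← Finset.smul_sum, List.map_append, List.map_singleton, List.prod_append,
        List.prod_singleton, coeff_mul, Finset.Nat.sum_antidiagonal_eq_sum_range_succ_mk]
    · simp

theorem strace_sMul {ι : Type} [Fintype ι] [DecidableEq ι] (m : ℕ)
    (A B : Matrix (ι → Fin N) (ι → Fin N) R) :
    strace m (sMul m A B) = ∑ r, ∑ s, chi (∑ v, parity m (r v) +
      (∑ v, parity m (s v) + ∑ v, parity m (r v)) *
        (∑ v, parity m (r v) + ∑ v, parity m (s v))) • (A r s * B s r) := by
  refine Finset.sum_congr rfl fun r _ => ?_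
  rw [neg_one_pow_mul, cast_mpar, sMul_apply, Finset.smul_sum]
  exact Finset.sum_congr rfl fun s _ => by rw [smul_smul, ← chi_add]

theorem sMul_kron_diagonal {ι : Type} [Fintype ι] [DecidableEq ι] (m : ℕ) (d : Fin N → ℂ)
    (B : Matrix (ι → Fin N) (ι → Fin N) R) (r t : ι → Fin N) :
    sMul m ((kron (ι := ι) (Matrix.diagonal d)).map (algebraMap ℂ R)) B r t =
      (∏ v, d (r v)) • B r t := by
  rw [sMul_apply, Finset.sum_eq_single r]
  · simp [kron, zmod_two_add_self, chi_zero, Algebra.smul_def]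
  · intro s _ hs
    obtain ⟨v, hv⟩ := Function.ne_iff.1 hs
    have : kron (ι := ι) (Matrix.diagonal d) r s = 0 :=
      Finset.prod_eq_zero (Finset.mem_univ v) (Matrix.diagonal_apply_ne _ hv.symm)
    simp [this]
  · simp

theorem cast_invExp {k : ℕ} (m : ℕ) (σ : Perm (Fin k)) (r : Fin k → Fin N) :
    ((invExp m (· < ·) σ (r ∘ σ) : ℕ) : ZMod 2) = inversionSum σ fun v => parity m (r v) := by
  rw [invExp, Finset.sum_filter, inversionSum]
  push_cast
  refine Finset.sum_congr rfl fun p _ => ?_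
  by_cases h : p.1 < p.2 ∧ σ p.2 < σ p.1
  · rw [if_pos h, if_pos h]; simp [cast_par]
  · rw [if_neg h, if_neg h]

/-- The supertrace of a combination of permutation operators times a diagonal operator times
`B`. -/
theorem strace_permMat_sum {k : ℕ} (m : ℕ) (d : Fin N → ℂ) (e : Perm (Fin k) → ℂ) (c : ℂ)
    (B : Matrix (Fin k → Fin N) (Fin k → Fin N) R) :
    strace m (sMul m ((c • ∑ σ, e σ • permMat (N := N) m (· < ·) σ :
        Matrix (Fin k → Fin N) (Fin k → Fin N) ℂ).map (algebraMap ℂ R))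
      (sMul m ((kron (ι := Fin k) (Matrix.diagonal d)).map (algebraMap ℂ R)) B)) =
    c • ∑ σ, e σ • ∑ r : Fin k → Fin N,
      (chi (∑ v, parity m (r v) + inversionSum σ fun v => parity m (r v)) * ∏ v, d (r v)) •
        B (r ∘ σ) r := by
  rw [strace_sMul]
  simp only [sMul_kron_diagonal, Matrix.map_apply, ← Algebra.smul_def, Matrix.smul_apply,
    Matrix.sum_apply, smul_eq_mul, mul_smul, Finset.sum_smul]
  simp only [Finset.smul_sum]
  rw [Finset.sum_comm (s := (Finset.univ : Finset (Perm (Fin k))))]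
  refine Finset.sum_congr rfl fun r _ => ?_
  rw [Finset.sum_comm]
  refine Finset.sum_congr rfl fun σ _ => ?_
  rw [Finset.sum_eq_single (r ∘ σ)]
  · have hr : r = (r ∘ σ) ∘ σ.symm := by ext; simp
    have hs : ∑ v, parity m ((r ∘ σ) v) = ∑ v, parity m (r v) :=
      Equiv.sum_comp σ fun v => parity m (r v)
    have hd : ∏ v, d ((r ∘ σ) v) = ∏ v, d (r v) := Equiv.prod_comp σ fun v => d (r v)
    rw [permMat, if_pos hr, hs, hd, ← mul_one ((-1 : ℂ) ^ _), neg_one_pow_mul, cast_invExp,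
      zmod_two_add_self, zero_mul, add_zero, smul_eq_mul, mul_one, chi_add]
    simp only [smul_smul]
    congr 1
    ring
  · intro s _ hs
    have hr : r ≠ s ∘ σ.symm := by
      rintro rfl
      exact hs (by ext; simp)
    rw [permMat, if_neg hr]
    simp
  · simp

end Evaluation

section Transfer
open PowerSeries Equiv

variable {m n : ℕ}

theorem TwedgeProd_apply (k p : ℕ) (r t : Fin k → Fin (m + n)) :
    TwedgeProd m n k p r t =
      chi (crossSum (fun v => parity m (r v)) fun v => parity m (t v)) •
        coeff p (descProd fun v => Tser ((k : ℂ) - 1 - (v : ℕ)) (r v) (t v)) := by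
  have h : ∀ v : Fin k, TfacY m n (· < ·) v ((k : ℂ) - 1 - (v : ℕ)) = fun p =>
      embed m (· < ·) v fun a b => coeff p (Tser ((k : ℂ) - 1 - (v : ℕ)) a b) := by
    intro v
    funext p
    simp only [TfacY, Tser, coeff_mk, serShiftS, Algebra.smul_def]
  have hl : (List.finRange k).reverse.Pairwise (· > ·) := by
    rw [List.pairwise_reverse]
    exact List.pairwise_lt_finRange k
  simp only [TwedgeProd, h]
  rw [serProd_apply m (fun v => Tser ((k : ℂ) - 1 - (v : ℕ))) _ hl, if_pos (by simp), descProd]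

theorem Phi_zero (d : Fin (m + n) → ℂ) (σ : Perm (Fin 0)) : Phi d 0 σ = 1 := by
  simp [Phi, descProd, koszul, inversionSum, crossSum, chi_zero]

theorem transferT_diagonal (d : Fin (m + n) → ℂ) (k p : ℕ) :
    transferT m n k (Matrix.diagonal d) p =
      coeff p ((k.factorial : ℂ)⁻¹ • ∑ σ, ((Perm.sign σ : ℤ) : ℂ) • Phi d k σ) := by
  rcases eq_or_ne k 0 with rfl | hk
  · simp [transferT, Phi_zero, coeff_one]
  rw [transferT, if_neg hk, asymmZ, strace_permMat_sum, coeff_smul, map_sum]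
  refine congrArg (_ • ·) (Finset.sum_congr rfl fun σ _ => ?_)
  rw [coeff_smul, Phi, map_sum]
  refine congrArg (_ • ·) (Finset.sum_congr rfl fun r _ => ?_)
  rw [TwedgeProd_apply, coeff_smul, smul_smul, koszul, chi_add _ (crossSum _ _)]
  simp only [Function.comp_apply]
  congr 1
  ring

end Transfer

section Join
open PowerSeries Equiv

variable {j i : ℕ}

/-- The block permutation of `Fin (j + i)` given by `τ` on the low and `σ` on the high block. -/
def joinPerm (τ : Perm (Fin j)) (σ : Perm (Fin i)) : Perm (Fin (j + i)) :=
  finSumFinEquiv.permCongr (Perm.sumCongr τ σ)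

@[simp]
theorem joinPerm_castAdd (τ : Perm (Fin j)) (σ : Perm (Fin i)) (v : Fin j) :
    joinPerm τ σ (Fin.castAdd i v) = Fin.castAdd i (τ v) := by
  simp [joinPerm, permCongr_apply]

@[simp]
theorem joinPerm_natAdd (τ : Perm (Fin j)) (σ : Perm (Fin i)) (v : Fin i) :
    joinPerm τ σ (Fin.natAdd j v) = Fin.natAdd j (σ v) := by
  simp [joinPerm, permCongr_apply]

theorem sign_joinPerm (τ : Perm (Fin j)) (σ : Perm (Fin i)) :
    Perm.sign (joinPerm τ σ) = Perm.sign τ * Perm.sign σ := by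
  rw [joinPerm, Perm.sign_permCongr, Perm.sign_sumCongr]

theorem joinPerm_eq_mul (τ : Perm (Fin j)) (σ : Perm (Fin i)) :
    joinPerm τ σ = joinPerm 1 σ * joinPerm τ 1 := by
  ext v
  induction v using Fin.addCases <;> simp

theorem joinPerm_one_mem (σ : Perm (Fin i)) :
    joinPerm (1 : Perm (Fin j)) σ ∈ permsOn (high (j + i) j) := by
  rw [mem_permsOn]
  intro x hx
  induction x using Fin.addCases with
  | left v => simp
  | right v => simp [high] at hx

theorem joinPerm_mem_low (τ : Perm (Fin j)) :
    joinPerm τ (1 : Perm (Fin i)) ∈ permsOn (low (j + i) j) := by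
  rw [mem_permsOn]
  intro x hx
  induction x using Fin.addCases with
  | left v => simp [low] at hx
  | right v => simp

theorem exists_joinPerm {ρ : Perm (Fin (j + i))}
    (h : ∀ v : Fin j, ∃ w : Fin j, ρ (Fin.castAdd i v) = Fin.castAdd i w) :
    ∃ τ σ, joinPerm τ σ = ρ := by
  have hm : (finSumFinEquiv.symm.permCongr ρ) ∈ (Perm.sumCongrHom (Fin j) (Fin i)).range := by
    refine Perm.mem_sumCongrHom_range_of_perm_mapsTo_inl ?_
    rintro _ ⟨v, rfl⟩
    obtain ⟨w, hw⟩ := h v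
    exact ⟨w, by simp [permCongr_apply, hw]⟩
  obtain ⟨⟨τ, σ⟩, hρ⟩ := hm
  refine ⟨τ, σ, ?_⟩
  have hρ' : Perm.sumCongr τ σ = finSumFinEquiv.symm.permCongr ρ := hρ
  rw [joinPerm, hρ']
  ext v
  simp [permCongr_apply]

theorem joinPerm_inj {τ τ' : Perm (Fin j)} {σ σ' : Perm (Fin i)} :
    joinPerm τ σ = joinPerm τ' σ' ↔ τ = τ' ∧ σ = σ' := by
  refine ⟨fun h => ⟨?_, ?_⟩, by rintro ⟨rfl, rfl⟩; rfl⟩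
  · ext v
    simpa using congrArg Fin.val (congrArg (fun ρ => ρ (Fin.castAdd i v)) h)
  · ext v
    simpa using congrArg Fin.val (congrArg (fun ρ => ρ (Fin.natAdd j v)) h)

theorem sum_permsOn_high {M : Type*} [AddCommMonoid M] (g : Perm (Fin (j + i)) → M) :
    ∑ ρ ∈ permsOn (high (j + i) j), g ρ = ∑ σ : Perm (Fin i), g (joinPerm 1 σ) := by
  refine (Finset.sum_bij (fun σ _ => joinPerm 1 σ) (fun σ _ => joinPerm_one_mem σ)
    (fun _ _ _ _ h => (joinPerm_inj.1 h).2) (fun ρ hρ => ?_) fun _ _ => rfl).symm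
  rw [mem_permsOn] at hρ
  have hfix : ∀ v : Fin j, ρ (Fin.castAdd i v) = Fin.castAdd i v :=
    fun v => hρ _ (by simp [high])
  obtain ⟨τ, σ, rfl⟩ := exists_joinPerm fun v => ⟨v, hfix v⟩
  refine ⟨σ, Finset.mem_univ _, joinPerm_inj.2 ⟨?_, rfl⟩⟩
  ext v
  simpa using (congrArg Fin.val (hfix v)).symm

theorem sum_permsOn_low {M : Type*} [AddCommMonoid M] (g : Perm (Fin (j + i)) → M) :
    ∑ ρ ∈ permsOn (low (j + i) j), g ρ = ∑ τ : Perm (Fin j), g (joinPerm τ 1) := by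
  refine (Finset.sum_bij (fun τ _ => joinPerm τ 1) (fun τ _ => joinPerm_mem_low τ)
    (fun _ _ _ _ h => (joinPerm_inj.1 h).1) (fun ρ hρ => ?_) fun _ _ => rfl).symm
  rw [mem_permsOn] at hρ
  have hfix : ∀ v : Fin i, ρ (Fin.natAdd j v) = Fin.natAdd j v :=
    fun v => hρ _ (by simp [low])
  have hex : ∀ v : Fin j, ∃ w : Fin j, ρ (Fin.castAdd i v) = Fin.castAdd i w := by
    intro v
    generalize hy : ρ (Fin.castAdd i v) = y
    induction y using Fin.addCases with
    | left w => exact ⟨w, rfl⟩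
    | right w =>
      have := congrArg Fin.val (ρ.injective (hy.trans (hfix w).symm))
      simp at this
      omega
  obtain ⟨τ, σ, rfl⟩ := exists_joinPerm hex
  refine ⟨τ, Finset.mem_univ _, joinPerm_inj.2 ⟨rfl, ?_⟩⟩
  ext v
  simpa using (congrArg Fin.val (hfix v)).symm

theorem castAdd_lt_castAdd (a b : Fin j) :
    (Fin.castAdd i a : Fin (j + i)) < Fin.castAdd i b ↔ a < b := Iff.rfl

theorem koszul_joinPerm (τ : Perm (Fin j)) (σ : Perm (Fin i)) (x : Fin (j + i) → ZMod 2) :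
    koszul (joinPerm τ σ) x =
      koszul τ (fun v => x (Fin.castAdd i v)) + koszul σ fun v => x (Fin.natAdd j v) := by
  have hinv : inversionSum (joinPerm τ σ) x = inversionSum τ (fun v => x (Fin.castAdd i v)) +
      inversionSum σ fun v => x (Fin.natAdd j v) := by
    simp only [inversionSum, Fintype.sum_prod_type, Fin.sum_univ_add, joinPerm_castAdd,
      joinPerm_natAdd]
    have h1 : ∀ (a : Fin j) (b : Fin i), ¬ (Fin.natAdd j b : Fin (j + i)) < Fin.castAdd i a := by
      intro a b
      simp only [Fin.lt_def, Fin.val_natAdd, Fin.val_castAdd]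
      omega
    simp [h1, castAdd_lt_castAdd]
  have hlow : ∀ w : Fin j, partialSum x (Fin.castAdd i w) =
      partialSum (fun v => x (Fin.castAdd i v)) w := by
    intro w
    have h1 : ∀ b : Fin i, ¬ (Fin.natAdd j b : Fin (j + i)) < Fin.castAdd i w := by
      intro b
      simp only [Fin.lt_def, Fin.val_natAdd, Fin.val_castAdd]
      omega
    simp only [partialSum, Finset.sum_filter, Fin.sum_univ_add]
    simp [h1, castAdd_lt_castAdd]
  have hhigh : ∀ w : Fin i, partialSum x (Fin.natAdd j w) =
      ∑ v, x (Fin.castAdd i v) + partialSum (fun v => x (Fin.natAdd j v)) w := by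
    intro w
    have h1 : ∀ a : Fin j, (Fin.castAdd i a : Fin (j + i)) < Fin.natAdd j w := by
      intro a
      simp only [Fin.lt_def, Fin.val_natAdd, Fin.val_castAdd]
      omega
    simp only [partialSum, Finset.sum_filter, Fin.sum_univ_add]
    simp [h1]
  have hcross : crossSum (fun v => x (joinPerm τ σ v)) x =
      crossSum (fun v => x (Fin.castAdd i (τ v))) (fun v => x (Fin.castAdd i v)) +
      crossSum (fun v => x (Fin.natAdd j (σ v))) (fun v => x (Fin.natAdd j v)) := by
    have hsum : ∑ w, (x (Fin.natAdd j (σ w)) + x (Fin.natAdd j w)) = 0 := by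
      rw [Finset.sum_add_distrib, Equiv.sum_comp σ fun w => x (Fin.natAdd j w),
        zmod_two_add_self]
    simp only [crossSum, Fin.sum_univ_add, hlow, hhigh, joinPerm_castAdd, joinPerm_natAdd, mul_add,
      Finset.sum_add_distrib]
    rw [← Finset.sum_mul, hsum, zero_mul, zero_add]
  simp only [koszul, Fin.sum_univ_add, hinv, hcross]
  ring

theorem descProd_add {R : Type*} [Monoid R] (f : Fin (j + i) → R) :
    descProd f =
      descProd (fun v => f (Fin.natAdd j v)) * descProd fun v => f (Fin.castAdd i v) := by
  induction i with
  | zero => simp [descProd]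
  | succ i ih =>
    rw [descProd_succ (fun v => f (Fin.natAdd j v)), mul_assoc]
    exact (descProd_succ (k := j + i) f).trans
      (congrArg _ (ih fun v : Fin (j + i) => f v.castSucc))

theorem map_descProd {R S F : Type*} [Monoid R] [Monoid S] [FunLike F R S] [MonoidHomClass F R S]
    (φ : F) {k : ℕ} (f : Fin k → R) : φ (descProd f) = descProd fun v => φ (f v) := by
  simp [descProd, map_list_prod, Function.comp_def]

variable {m n : ℕ}

theorem shiftHom_Tser (z w : ℂ) (a b : Fin (m + n)) :
    shiftHom z (Tser w a b) = Tser (z + w) a b := by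
  rw [Tser, Tser, ← shiftHom_mk, ← shiftHom_mk, shiftHom_shiftHom]

theorem Phi_mul_shiftHom (d : Fin (m + n) → ℂ) (τ : Perm (Fin j)) (σ : Perm (Fin i)) :
    Phi d i σ * shiftHom (i : ℂ) (Phi d j τ) = Phi d (j + i) (joinPerm τ σ) := by
  rw [Phi, Phi, Phi, map_sum, Finset.sum_mul_sum, Finset.sum_comm, ← Fintype.sum_prod_type']
  refine Fintype.sum_equiv (Fin.appendEquiv j i) _ _ fun r => ?_
  rw [map_smul, map_descProd, smul_mul_smul_comm, koszul_joinPerm, descProd_add, Fin.prod_univ_add,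
    chi_add]
  simp only [Fin.appendEquiv, Equiv.coe_fn_mk, Fin.append_left, Fin.append_right, joinPerm_natAdd,
    joinPerm_castAdd, shiftHom_Tser]
  congr 1
  · ring
  · congr 3
    all_goals
      funext v
      congr 1
      simp only [Fin.val_natAdd, Fin.val_castAdd]
      push_cast
      ring

end Join

section Dual
open PowerSeries Equiv

theorem chi_sum {ι : Type*} (s : Finset ι) (e : ι → ZMod 2) :
    chi (∑ v ∈ s, e v) = ∏ v ∈ s, chi (e v) := by
  classical
  induction s using Finset.induction_on with
  | empty => simp [chi_zero]
  | insert a s ha ih => rw [Finset.sum_insert ha, Finset.prod_insert ha, chi_add, ih]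

theorem chi_mul_self (e : ZMod 2) : chi e * chi e = 1 := by
  rw [← chi_add, zmod_two_add_self, chi_zero]

theorem descProd_smul {R : Type*} [Ring R] [Algebra ℂ R] {k : ℕ} (c : Fin k → ℂ) (f : Fin k → R) :
    descProd (fun v => c v • f v) = (∏ v, c v) • descProd f := by
  induction k with
  | zero => simp [descProd]
  | succ k ih =>
    rw [descProd_succ, ih, descProd_succ f, smul_mul_smul_comm, Fin.prod_univ_castSucc, mul_comm]

variable {m n : ℕ}

/-- The bijection `a ↦ a'` of index sets. -/
def dualEquiv (m n : ℕ) : Fin (m + n) ≃ Fin (n + m) :=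
  Fin.revPerm.trans (finCongr (Nat.add_comm m n))

theorem cast_rev_dualIdx (a : Fin (m + n)) :
    Fin.cast (Nat.add_comm n m) (dualIdx a).rev = a := by
  ext
  simp only [dualIdx, Fin.val_cast, Fin.val_rev]
  omega

theorem parity_dualIdx (a : Fin (m + n)) : parity n (dualIdx a) = 1 + parity m a := by
  have h2 : (1 + 1 : ZMod 2) = 0 := by decide
  have hv : (dualIdx a : ℕ) = m + n - (a + 1) := by
    simp only [dualIdx, Fin.val_cast, Fin.val_rev]
  simp only [parity, par, parN]
  by_cases h : (a : ℕ) < m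
  · rw [if_pos h, if_neg (by omega)]; simp
  · rw [if_neg h, if_pos (by omega)]; simp [h2]

/-- The coefficientwise extension of `vpi` to series. -/
def seriesMap (vpi : Yangian m n →ₐ[ℂ] Yangian n m) :
    (Yangian m n)⟦X⟧ →+* (Yangian n m)⟦X⟧ := PowerSeries.map (vpi : Yangian m n →+* Yangian n m)

theorem coeff_seriesMap (vpi : Yangian m n →ₐ[ℂ] Yangian n m) (F : (Yangian m n)⟦X⟧) (p : ℕ) :
    coeff p (seriesMap vpi F) = vpi (coeff p F) := rfl

theorem seriesMap_smul (vpi : Yangian m n →ₐ[ℂ] Yangian n m) (c : ℂ) (F : (Yangian m n)⟦X⟧) :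
    seriesMap vpi (c • F) = c • seriesMap vpi F := by
  ext p
  rw [coeff_seriesMap, coeff_smul, coeff_smul, map_smul, coeff_seriesMap]

theorem seriesMap_Tser {vpi : Yangian m n →ₐ[ℂ] Yangian n m}
    (hvpi : ∀ (a b : Fin (m + n)) (s : ℕ),
      vpi (TT m n a b s) =
        ((-1 : ℂ) ^ (par n (dualIdx a) * par n (dualIdx b) + par n (dualIdx b))) •
          TT n m (dualIdx b) (dualIdx a) s) (z : ℂ) (a b : Fin (m + n)) :
    seriesMap vpi (Tser z a b) =
      chi ((1 + parity m a) * (1 + parity m b) + (1 + parity m b)) •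
        Tser z (dualIdx b) (dualIdx a) := by
  ext p
  rw [coeff_seriesMap, coeff_smul, Tser, Tser, coeff_mk, coeff_mk, serShiftS, serShiftS, map_sum,
    Finset.smul_sum]
  refine Finset.sum_congr rfl fun s _ => ?_
  rw [map_smul, hvpi, smul_comm, ← parity_dualIdx, ← parity_dualIdx, ← chi_natCast]
  push_cast
  rfl

theorem seriesMap_Phi {vpi : Yangian m n →ₐ[ℂ] Yangian n m}
    (hvpi : ∀ (a b : Fin (m + n)) (s : ℕ),
      vpi (TT m n a b s) =
        ((-1 : ℂ) ^ (par n (dualIdx a) * par n (dualIdx b) + par n (dualIdx b))) •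
          TT n m (dualIdx b) (dualIdx a) s) (d : Fin (m + n) → ℂ) {k : ℕ} (σ : Perm (Fin k)) :
    seriesMap vpi (Phi d k σ) = (((-1) ^ k * ((Perm.sign σ : ℤ) : ℂ))) •
      Phi (fun c => d (Fin.cast (Nat.add_comm n m) c.rev)) k σ⁻¹ := by
  rw [Phi, Phi, map_sum, Finset.smul_sum]
  refine Fintype.sum_equiv (σ.symm.arrowCongr (dualEquiv m n)) _ _ fun r => ?_
  have hr : ∀ v, σ.symm.arrowCongr (dualEquiv m n) r v = dualIdx (r (σ v)) := fun _ => rfl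
  have hσ : ∀ v, σ (σ⁻¹ v) = v := σ.apply_symm_apply
  have hd : ∏ v, d (r (σ v)) = ∏ v, d (r v) := Equiv.prod_comp σ fun v => d (r v)
  simp only [hr, hσ, cast_rev_dualIdx, hd, parity_dualIdx]
  rw [seriesMap_smul, map_descProd]
  simp only [seriesMap_Tser hvpi]
  rw [descProd_smul, smul_smul, smul_smul, ← chi_sum, ← chi_natCast, ← chi_signBit]
  congr 1
  have e : ∀ a b : ZMod 2, (1 + a) * (1 + b) + (1 + b) = a * b + a := by decide
  have h := congrArg chi (koszul_inv σ fun v => parity m (r v))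
  simp only [chi_add] at h
  simp only [e]
  linear_combination (∏ v, d (r v)) * h

theorem vpi_DQop {vpi : Yangian m n →ₐ[ℂ] Yangian n m}
    (hvpi : ∀ (a b : Fin (m + n)) (s : ℕ),
      vpi (TT m n a b s) =
        ((-1 : ℂ) ^ (par n (dualIdx a) * par n (dualIdx b) + par n (dualIdx b))) •
          TT n m (dualIdx b) (dualIdx a) s) (d : Fin (m + n) → ℂ) (k p : ℕ) :
    vpi (DQop m n (Matrix.diagonal d) k p) = coeff p ((k.factorial : ℂ)⁻¹ • ∑ σ,
      Phi (fun c => d (Fin.cast (Nat.add_comm n m) c.rev)) k σ) := by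
  rw [DQop, transferT_diagonal, ← coeff_smul, ← coeff_seriesMap, smul_comm, seriesMap_smul,
    seriesMap_smul, map_sum, Finset.smul_sum, ← Equiv.sum_comp (Equiv.inv (Perm (Fin k)))]
  refine congrArg (fun F => coeff p (_ • F)) (Finset.sum_congr rfl fun σ _ => ?_)
  rw [seriesMap_smul, seriesMap_Phi hvpi, smul_smul, smul_smul, Equiv.inv_apply, inv_inv,
    ← chi_natCast, Perm.sign_inv, ← chi_signBit]
  rw [← chi_add, chi_mul_self, one_smul]

/-- Product of difference operators given by their series coefficients. -/
theorem dopMulS_coeff {R : Type} [Ring R] [Algebra ℂ R] (U W : ℕ → R⟦X⟧) (k p : ℕ) :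
    dopMulS (fun k p => coeff p (U k)) (fun k p => coeff p (W k)) k p =
      coeff p (∑ i ∈ Finset.range (k + 1), U i * shiftHom (i : ℂ) (W (k - i))) := by
  rw [map_sum]
  refine Finset.sum_congr rfl fun i _ => ?_
  rw [coeff_mul, Finset.Nat.sum_antidiagonal_eq_sum_range_succ_mk, serMulS]
  simp only [coeff_shiftHom]

theorem sum_smul_Phi_mul (d : Fin (m + n) → ℂ) {k j : ℕ} (hj : j ≤ k) (a b : ℤˣ →* ℤˣ) :
    (∑ σ, ((a (Perm.sign σ) : ℤ) : ℂ) • Phi d (k - j) σ) *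
      shiftHom ((k - j : ℕ) : ℂ) (∑ τ, ((b (Perm.sign τ) : ℤ) : ℂ) • Phi d j τ) =
    ∑ ρ ∈ permsOn (high k j), ∑ h ∈ permsOn (low k j),
      ((a (Perm.sign ρ) : ℤ) : ℂ) • ((b (Perm.sign h) : ℤ) : ℂ) • Phi d k (ρ * h) := by
  obtain ⟨i, rfl⟩ := Nat.exists_eq_add_of_le hj
  rw [Nat.add_sub_cancel_left, sum_permsOn_high, map_sum, Finset.sum_mul_sum]
  refine Finset.sum_congr rfl fun σ _ => ?_
  rw [sum_permsOn_low]
  refine Finset.sum_congr rfl fun τ _ => ?_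
  rw [map_smul, smul_mul_smul_comm, Phi_mul_shiftHom, mul_smul, ← joinPerm_eq_mul, sign_joinPerm,
    sign_joinPerm, Perm.sign_one, Perm.sign_one, one_mul, mul_one]

end Dual

section Inverse
open PowerSeries Equiv

variable {m n : ℕ}

/-- The transfer matrices of the symmetric powers, as series. -/
def symmSeries (d : Fin (m + n) → ℂ) (k : ℕ) : (Yangian m n)⟦X⟧ :=
  (k.factorial : ℂ)⁻¹ • ∑ σ, Phi d k σ

/-- The coefficients of the difference operator, as series. -/
def DSeries (d : Fin (m + n) → ℂ) (k : ℕ) : (Yangian m n)⟦X⟧ :=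
  (-1 : ℂ) ^ k • (k.factorial : ℂ)⁻¹ • ∑ σ, ((Perm.sign σ : ℤ) : ℂ) • Phi d k σ

theorem symmSeries_mul_DSeries (d : Fin (m + n) → ℂ) {k j : ℕ} (hj : j ≤ k) :
    symmSeries d (k - j) * shiftHom ((k - j : ℕ) : ℂ) (DSeries d j) =
      ((-1 : ℂ) ^ j * ((j.factorial : ℂ) * ((k - j).factorial : ℂ))⁻¹) •
        ∑ τ ∈ permsOn (high k j), ∑ h ∈ permsOn (low k j),
          ((Perm.sign h : ℤ) : ℂ) • Phi d k (τ * h) := by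
  have h := sum_smul_Phi_mul d hj 1 (MonoidHom.id _)
  simp only [MonoidHom.one_apply, MonoidHom.id_apply, Units.val_one, Int.cast_one, one_smul] at h
  rw [symmSeries, DSeries, map_smul, map_smul, smul_mul_assoc, mul_smul_comm, mul_smul_comm, h,
    smul_smul, smul_smul, mul_inv]
  congr 1
  ring

theorem DSeries_mul_symmSeries (d : Fin (m + n) → ℂ) {k j : ℕ} (hj : j ≤ k) :
    DSeries d (k - j) * shiftHom ((k - j : ℕ) : ℂ) (symmSeries d j) =
      ((-1 : ℂ) ^ (k - j) * ((j.factorial : ℂ) * ((k - j).factorial : ℂ))⁻¹) •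
        ∑ τ ∈ permsOn (high k j), ∑ h ∈ permsOn (low k j),
          ((Perm.sign τ : ℤ) : ℂ) • Phi d k (τ * h) := by
  have h := sum_smul_Phi_mul d hj (MonoidHom.id _) 1
  simp only [MonoidHom.one_apply, MonoidHom.id_apply, Units.val_one, Int.cast_one, one_smul] at h
  rw [symmSeries, DSeries, map_smul, mul_smul_comm, smul_mul_assoc, smul_mul_assoc, h,
    smul_smul, smul_smul, mul_inv]
  congr 1
  ring

theorem symmSeries_zero (d : Fin (m + n) → ℂ) : symmSeries d 0 = 1 := by
  simp [symmSeries, Phi_zero]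

theorem DSeries_zero (d : Fin (m + n) → ℂ) : DSeries d 0 = 1 := by
  simp [DSeries, Phi_zero]

theorem dopMulS_eq_one {R : Type} [Ring R] [Algebra ℂ R] {U W : ℕ → R⟦X⟧} (hU : U 0 = 1)
    (hW : W 0 = 1) (h : ∀ k ≠ 0, ∑ j ∈ Finset.range (k + 1),
      U (k - j) * shiftHom ((k - j : ℕ) : ℂ) (W j) = 0) :
    dopMulS (fun k p => coeff p (U k)) (fun k p => coeff p (W k)) = dopOneS := by
  funext k p
  rw [dopMulS_coeff, dopOneS]
  rcases eq_or_ne k 0 with rfl | hk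
  · simp [hU, hW, coeff_one]
  · have h' := h k hk
    rw [← Finset.sum_range_reflect] at h'
    have : ∑ i ∈ Finset.range (k + 1), U i * shiftHom (i : ℂ) (W (k - i)) = 0 := by
      rw [← h']
      refine Finset.sum_congr rfl fun i hi => ?_
      have hi' : k - (k + 1 - 1 - i) = i := by
        rw [Finset.mem_range] at hi
        omega
      rw [hi', Nat.add_sub_cancel]
    rw [this, map_zero, if_neg fun h => hk h.1]

theorem DQop_diagonal (d : Fin (m + n) → ℂ) :
    DQop m n (Matrix.diagonal d) = fun k p => coeff p (DSeries d k) := by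
  funext k p
  rw [DQop, transferT_diagonal, DSeries, ← coeff_smul]

end Inverse

theorem statement13 (m n : ℕ) (d : Fin (m + n) → ℂ)
    (vpi : Yangian m n →ₐ[ℂ] Yangian n m)
    (hvpi : ∀ (a b : Fin (m + n)) (s : ℕ),
      vpi (TT m n a b s) =
        ((-1 : ℂ) ^ (par n (dualIdx a) * par n (dualIdx b) + par n (dualIdx b))) •
          TT n m (dualIdx b) (dualIdx a) s) :
    (dopMulS (fun k p => vpi (DQop m n (Matrix.diagonal d) k p))
        (DQop n m (Matrix.diagonal fun c => d (Fin.cast (Nat.add_comm n m) c.rev)))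
      = dopOneS)
    ∧ (dopMulS (DQop n m (Matrix.diagonal fun c => d (Fin.cast (Nat.add_comm n m) c.rev)))
        (fun k p => vpi (DQop m n (Matrix.diagonal d) k p))
      = dopOneS) := by
  have hH : (fun k p => vpi (DQop m n (Matrix.diagonal d) k p)) = fun k p =>
      PowerSeries.coeff p (symmSeries (fun c => d (Fin.cast (Nat.add_comm n m) c.rev)) k) := by
    funext k p
    exact vpi_DQop hvpi d k p
  rw [hH, DQop_diagonal]
  generalize (fun c : Fin (n + m) => d (Fin.cast (Nat.add_comm n m) c.rev)) = e
  constructor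
  · refine dopMulS_eq_one (symmSeries_zero e) (DSeries_zero e) fun k hk => ?_
    rw [← (isManin_Phi e k).sum_high_low hk]
    exact Finset.sum_congr rfl fun j hj =>
      symmSeries_mul_DSeries e (Nat.lt_succ_iff.1 (Finset.mem_range.1 hj))
  · refine dopMulS_eq_one (DSeries_zero e) (symmSeries_zero e) fun k hk => ?_
    rw [← (isManin_Phi e k).sum_low_high hk]
    exact Finset.sum_congr rfl fun j hj =>
      DSeries_mul_symmSeries e (Nat.lt_succ_iff.1 (Finset.mem_range.1 hj))

end Paper
end
end

section
/- Let Q ∈ End(V) be an even matrix and set 𝒩 = m − n. For any integers l ≥ k ≥ 1 and any pairwise distinct i_1, …, i_k ∈ {1, …, l}: (str_{V^{⊗l}} ⊗ id)(Q^{(i_1)} ⋯ Q^{(i_k)} T^{(i_1,l+1)}(u) T^{(i_2,l+1)}(u−1) ⋯ T^{(i_k,l+1)}(u−k+1) A_l^{(1⋯l)}) = (k!/l!) · ∏_{j=k}^{l−1} (𝒩 − j) · 𝒯_{k,Q}(u). -/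
noncomputable section
namespace Paper

section Signs

theorem neg_one_pow_congr_zmod {R : Type} [Ring R] {a b : ℕ} (h : (a : ZMod 2) = b) :
    (-1 : R) ^ a = (-1) ^ b := by
  rw [neg_one_pow_eq_pow_mod_two a, neg_one_pow_eq_pow_mod_two b,
    (ZMod.natCast_eq_natCast_iff' a b 2).1 h]

theorem ZMod.two_add_self (x : ZMod 2) : x + x = 0 := by revert x; decide

/-- The quadratic form over `ZMod 2` attached to the inversions of a permutation. -/
def invForm {l : ℕ} (σ : Equiv.Perm (Fin l)) (a : Fin l → ZMod 2) : ZMod 2 :=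
  ∑ x, ∑ y, if x < y ∧ σ y < σ x then a x * a y else 0

/-- Parities of the components of a multi-index, in `ZMod 2`. -/
def zpar (m : ℕ) {N l : ℕ} (s : Fin l → Fin N) : Fin l → ZMod 2 := fun x => (par m (s x) : ZMod 2)

theorem cast_invExp_s14 (m : ℕ) {N l : ℕ} (σ : Equiv.Perm (Fin l)) (s : Fin l → Fin N) :
    (invExp m (· < ·) σ s : ZMod 2) = invForm σ (zpar m s) := by
  simp [invExp, invForm, zpar, Finset.sum_filter, Fintype.sum_prod_type]

theorem cast_mpar_s14 (m : ℕ) {N l : ℕ} (s : Fin l → Fin N) :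
    (mpar m s : ZMod 2) = ∑ x, zpar m s x := by
  simp [mpar, zpar]

theorem invForm_mul {l : ℕ} (σ τ : Equiv.Perm (Fin l)) (a : Fin l → ZMod 2) :
    invForm (σ * τ) a = invForm σ (a ∘ τ.symm) + invForm τ a := by
  have h : invForm σ (a ∘ τ.symm) =
      ∑ x, ∑ y, if τ x < τ y ∧ σ (τ y) < σ (τ x) then a x * a y else 0 := by
    unfold invForm
    rw [← Equiv.sum_comp τ]
    refine Finset.sum_congr rfl fun x _ => ?_
    rw [← Equiv.sum_comp τ]
    simp
  have key : invForm (σ * τ) a + (invForm σ (a ∘ τ.symm) + invForm τ a) = 0 := by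
    rw [h]
    unfold invForm
    simp only [← Finset.sum_add_distrib]
    rw [← Fintype.sum_prod_type' (f := fun x y =>
      (if x < y ∧ (σ * τ) y < (σ * τ) x then a x * a y else 0) +
      ((if τ x < τ y ∧ σ (τ y) < σ (τ x) then a x * a y else 0) +
        if x < y ∧ τ y < τ x then a x * a y else 0))]
    have main : ∀ x y : Fin l, x ≠ y →
        (((if x < y ∧ (σ * τ) y < (σ * τ) x then a x * a y else 0) +
        ((if τ x < τ y ∧ σ (τ y) < σ (τ x) then a x * a y else 0) +
          if x < y ∧ τ y < τ x then a x * a y else 0)) +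
        ((if y < x ∧ (σ * τ) x < (σ * τ) y then a y * a x else 0) +
        ((if τ y < τ x ∧ σ (τ x) < σ (τ y) then a y * a x else 0) +
          if y < x ∧ τ x < τ y then a y * a x else 0))) = 0 := by
      intro x y hxy
      have h2 : τ x ≠ τ y := τ.injective.ne hxy
      have h3 : σ (τ x) ≠ σ (τ y) := σ.injective.ne h2
      simp only [Equiv.Perm.mul_apply, mul_comm (a y) (a x)]
      have h0 := ZMod.two_add_self (a x * a y)
      rcases lt_or_gt_of_ne hxy with h1 | h1 <;> rcases lt_or_gt_of_ne h2 with h2 | h2 <;>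
        rcases lt_or_gt_of_ne h3 with h3 | h3 <;>
        simp [h1, h2, h3, not_lt_of_gt h1, not_lt_of_gt h2, not_lt_of_gt h3, h0]
    refine Finset.sum_involution (fun p _ => p.swap) ?_ ?_ (by simp) (by simp)
    · rintro ⟨x, y⟩ _
      by_cases hxy : x = y
      · subst hxy; simp
      · exact main x y hxy
    · rintro ⟨x, y⟩ _ hne heq
      simp only [Prod.swap_prod_mk, Prod.mk.injEq] at heq
      obtain ⟨rfl, -⟩ := heq
      simp at hne
  linear_combination key - ZMod.two_add_self (invForm σ (a ∘ τ.symm) + invForm τ a)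

theorem invForm_update {l : ℕ} (σ : Equiv.Perm (Fin l)) (v : Fin l) (a b : Fin l → ZMod 2)
    (h : ∀ w, w ≠ v → b w = a w) :
    invForm σ b = invForm σ a + (b v + a v) *
      ((∑ w, if w < v then a w else 0) + ∑ w, if σ w < σ v then a w else 0) := by
  have hb : ∀ w, b w = a w + if w = v then b v + a v else 0 := by
    intro w
    by_cases hw : w = v
    · subst hw
      simp only [if_true]
      linear_combination -ZMod.two_add_self (a w)
    · simp [hw, h w hw]
  generalize b v + a v = d at *
  have expand : ∀ x y : Fin l, (if x < y ∧ σ y < σ x then b x * b y else 0) =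
      (if x < y ∧ σ y < σ x then a x * a y else 0) +
      ((if y = v then (if x < v ∧ σ v < σ x then d * a x else 0) else 0) +
       (if x = v then (if v < y ∧ σ y < σ v then d * a y else 0) else 0)) := by
    intro x y
    rw [hb x, hb y]
    by_cases hx : x = v <;> by_cases hy : y = v
    · subst hx; subst hy; simp
    · subst hx; simp only [hy, if_true, if_false]; split_ifs <;> ring
    · subst hy; simp only [hx, if_true, if_false]; split_ifs <;> ring
    · simp [hx, hy]
  unfold invForm
  simp only [expand, Finset.sum_add_distrib, Finset.sum_ite_eq', Finset.mem_univ, if_true]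
  rw [Finset.sum_comm (f := fun x y =>
    if x = v then (if v < y ∧ σ y < σ v then d * a y else 0) else 0)]
  simp only [Finset.sum_ite_eq', Finset.mem_univ, if_true]
  congr 1
  rw [mul_add, Finset.mul_sum, Finset.mul_sum, ← Finset.sum_add_distrib,
    ← Finset.sum_add_distrib]
  refine Finset.sum_congr rfl fun w _ => ?_
  by_cases hw : w = v
  · subst hw; simp
  · have h2 : σ w ≠ σ v := σ.injective.ne hw
    have h0 := ZMod.two_add_self (d * a w)
    rcases lt_or_gt_of_ne hw with h1 | h1 <;> rcases lt_or_gt_of_ne h2 with h2 | h2 <;>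
      simp [h1, h2, not_lt_of_gt h1, not_lt_of_gt h2, h0]

theorem invForm_swap {l : ℕ} (j : Fin l) (a : Fin (l + 1) → ZMod 2) (h : a 0 = a j.succ) :
    invForm (Equiv.swap 0 j.succ) a = a 0 * a 0 := by
  set σ := Equiv.swap 0 j.succ with hσ
  have hfix : ∀ w, w ≠ 0 → w ≠ j.succ → σ w = w := fun w => Equiv.swap_apply_of_ne_of_ne
  have hj : j.succ ≠ 0 := Fin.succ_ne_zero j
  set a₁ : Fin (l + 1) → ZMod 2 := Function.update a j.succ 0 with ha₁
  set a₀ : Fin (l + 1) → ZMod 2 := Function.update a₁ 0 0 with ha₀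
  have e1 := invForm_update σ j.succ a₁ a (fun w hw => by simp [ha₁, hw])
  have e0 := invForm_update σ 0 a₀ a₁ (fun w hw => by simp [ha₀, hw])
  have z : invForm σ a₀ = 0 := by
    refine Finset.sum_eq_zero fun x _ => Finset.sum_eq_zero fun y _ => ?_
    by_cases hx : x = 0 ∨ x = j.succ
    · have : a₀ x = 0 := by rcases hx with rfl | rfl <;> simp [ha₀, ha₁, hj]
      simp [this]
    by_cases hy : y = 0 ∨ y = j.succ
    · have : a₀ y = 0 := by rcases hy with rfl | rfl <;> simp [ha₀, ha₁, hj]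
      simp [this]
    push Not at hx hy
    rw [hfix x hx.1 hx.2, hfix y hy.1 hy.2, if_neg]
    exact fun h => lt_asymm h.1 h.2
  have s1 : (∑ w, if w < j.succ then a₁ w else 0) =
      a 0 + ∑ w, if w < j.succ then a₀ w else 0 := by
    rw [Fin.sum_univ_succ, Fin.sum_univ_succ (n := l)]
    simp [ha₀, ha₁, hj.symm]
  have s0 : (∑ w, if σ w < σ 0 then a₀ w else 0) = ∑ w, if w < j.succ then a₀ w else 0 := by
    refine Finset.sum_congr rfl fun w _ => ?_
    by_cases hw : w = 0 ∨ w = j.succ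
    · have : a₀ w = 0 := by rcases hw with rfl | rfl <;> simp [ha₀, ha₁, hj]
      simp [this]
    · push Not at hw
      rw [hfix w hw.1 hw.2, show σ 0 = j.succ by simp [hσ]]
  rw [e1, e0, z, s0, s1, show σ j.succ = 0 by simp [hσ]]
  have v1 : a₁ j.succ = 0 := by simp [ha₁]
  have v2 : a₀ 0 = 0 := by simp [ha₀]
  have v3 : a₁ 0 = a 0 := by simp [ha₁, hj.symm]
  simp only [v1, v2, v3, ← h, Fin.not_lt_zero, if_false, Finset.sum_const_zero]
  linear_combination ZMod.two_add_self (a 0 * ∑ w, if w < j.succ then a₀ w else 0)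

end Signs

section Untwisting

variable {R : Type} [Ring R] {l N : ℕ}

theorem neg_one_pow_mul_mul (a b : ℕ) (x y : R) :
    ((-1) ^ a * x) * ((-1) ^ b * y) = (-1) ^ (a + b) * (x * y) := by
  rcases neg_one_pow_eq_or R b with h | h <;> simp [pow_add, h, mul_assoc]

/-- The parity operator of `V^{⊗l}`. -/
def grade (m : ℕ) : Matrix (Fin l → Fin N) (Fin l → Fin N) R :=
  Matrix.diagonal fun r => (-1) ^ mpar m r

/-- The sign change turning the graded product `sMul` into the product of matrices. -/
def twist (m : ℕ) (A : Matrix (Fin l → Fin N) (Fin l → Fin N) R) :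
    Matrix (Fin l → Fin N) (Fin l → Fin N) R :=
  fun r s => (-1) ^ (mpar m s * (mpar m r + mpar m s)) * A r s

/-- The operator `embed` after untwisting. -/
def site (m : ℕ) (v : Fin l) (f : Fin N → Fin N → R) :
    Matrix (Fin l → Fin N) (Fin l → Fin N) R := fun r s =>
  if ∀ w, w ≠ v → r w = s w then
    (-1) ^ ((par m (r v) + par m (s v)) *
      (mpar m s + ∑ w ∈ Finset.univ.filter (fun w => w < v), par m (s w))) * f (r v) (s v)
  else 0

theorem twist_sMul (m : ℕ) (A B : Matrix (Fin l → Fin N) (Fin l → Fin N) R) :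
    twist m (sMul m A B) = twist m A * twist m B := by
  ext r t
  simp only [twist, sMul, Matrix.mul_apply, Finset.mul_sum]
  refine Finset.sum_congr rfl fun s _ => ?_
  rw [neg_one_pow_mul_mul, mul_assoc, ← mul_assoc, ← pow_add]
  congr 1
  apply neg_one_pow_congr_zmod
  push_cast
  linear_combination ZMod.two_add_self ((mpar m t : ZMod 2) * mpar m r)

theorem twist_sum {κ : Type} (m : ℕ) (S : Finset κ)
    (A : κ → Matrix (Fin l → Fin N) (Fin l → Fin N) R) :
    twist m (∑ q ∈ S, A q) = ∑ q ∈ S, twist m (A q) := by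
  ext r s
  simp [twist, Matrix.sum_apply, Finset.mul_sum]

/-- The operator preserves the parity of multi-indices. -/
def PreservesParity (m : ℕ) (A : Matrix (Fin l → Fin N) (Fin l → Fin N) R) : Prop :=
  ∀ r s, (mpar m r : ZMod 2) ≠ mpar m s → A r s = 0

theorem twist_eq_self (m : ℕ) (A : Matrix (Fin l → Fin N) (Fin l → Fin N) R)
    (h : PreservesParity m A) : twist m A = A := by
  ext r s
  by_cases hrs : (mpar m r : ZMod 2) = mpar m s
  · have : (-1 : R) ^ (mpar m s * (mpar m r + mpar m s)) = (-1) ^ 0 := by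
      apply neg_one_pow_congr_zmod
      push_cast
      rw [hrs, ZMod.two_add_self, mul_zero]
    simp [twist, this]
  · simp [twist, h r s hrs]

theorem strace_eq_trace (m : ℕ) (A : Matrix (Fin l → Fin N) (Fin l → Fin N) R) :
    strace m A = (grade m * twist m A).trace := by
  simp only [strace, grade, Matrix.trace, Matrix.diag_apply, Matrix.diagonal_mul, twist]
  refine Finset.sum_congr rfl fun r _ => ?_
  have : (-1 : R) ^ (mpar m r * (mpar m r + mpar m r)) = (-1) ^ 0 := by
    apply neg_one_pow_congr_zmod
    push_cast
    rw [ZMod.two_add_self, mul_zero]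
  simp [this]

theorem mpar_of_eq_off (m : ℕ) (v : Fin l) {r s : Fin l → Fin N} (h : ∀ w, w ≠ v → r w = s w) :
    (mpar m r : ZMod 2) = mpar m s + (par m (r v) + par m (s v)) := by
  rw [cast_mpar_s14, cast_mpar_s14, ← Finset.add_sum_erase _ _ (Finset.mem_univ v),
    ← Finset.add_sum_erase _ (zpar m s) (Finset.mem_univ v)]
  have : ∑ x ∈ Finset.univ.erase v, zpar m r x = ∑ x ∈ Finset.univ.erase v, zpar m s x :=
    Finset.sum_congr rfl fun x hx => by simp [zpar, h x (Finset.ne_of_mem_erase hx)]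
  rw [this]
  simp only [zpar]
  linear_combination -ZMod.two_add_self (par m (s v) : ZMod 2)

theorem twist_embed (m : ℕ) (v : Fin l) (f : Fin N → Fin N → R) :
    twist m (embed m (· < ·) v f) = site m v f := by
  ext r s
  simp only [twist, embed, site]
  split_ifs with h
  · rw [← mul_assoc, ← pow_add]
    congr 1
    apply neg_one_pow_congr_zmod
    push_cast
    rw [mpar_of_eq_off m v h]
    linear_combination ZMod.two_add_self ((mpar m s : ZMod 2) * mpar m s)
  · simp

theorem embed_even_apply (m : ℕ) (v : Fin l) (f : Fin N → Fin N → R)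
    (hf : ∀ a b, par m a ≠ par m b → f a b = 0) (r s : Fin l → Fin N) :
    embed m (· < ·) v f r s = if ∀ w, w ≠ v → r w = s w then f (r v) (s v) else 0 := by
  simp only [embed]
  split_ifs with h
  · by_cases hp : par m (r v) = par m (s v)
    · have : ∀ c : ℕ, (-1 : R) ^ ((par m (r v) + par m (s v)) * c) = (-1) ^ 0 := fun c => by
        apply neg_one_pow_congr_zmod
        push_cast
        rw [hp, ZMod.two_add_self, zero_mul]
      simp [this]
    · simp [hf _ _ hp]
  · rfl

theorem preservesParity_embed (m : ℕ) (v : Fin l) (f : Fin N → Fin N → R)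
    (hf : ∀ a b, par m a ≠ par m b → f a b = 0) :
    PreservesParity m (embed m (· < ·) v f) := by
  intro r s hrs
  rw [embed_even_apply m v f hf]
  split_ifs with h
  · refine hf _ _ fun hp => hrs ?_
    rw [mpar_of_eq_off m v h, hp, ZMod.two_add_self, add_zero]
  · rfl

theorem site_even (m : ℕ) (v : Fin l) (f : Fin N → Fin N → R)
    (hf : ∀ a b, par m a ≠ par m b → f a b = 0) :
    site m v f = embed m (· < ·) v f := by
  rw [← twist_embed]
  exact twist_eq_self m _ (preservesParity_embed m v f hf)

theorem coeff_prod_twist (m : ℕ) (L : List (ℕ → Matrix (Fin l → Fin N) (Fin l → Fin N) R))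
    (p : ℕ) :
    twist m (serProd m L p) =
      PowerSeries.coeff p (L.map fun F => PowerSeries.mk fun q => twist m (F q)).prod := by
  have key : ∀ G : ℕ → Matrix (Fin l → Fin N) (Fin l → Fin N) R,
      (PowerSeries.mk fun q => twist m (L.foldl (serMul m) G q)) =
        (PowerSeries.mk fun q => twist m (G q)) *
          (L.map fun F => PowerSeries.mk fun q => twist m (F q)).prod := by
    induction L with
    | nil => intro G; simp
    | cons F L ih =>
      intro G
      rw [List.foldl_cons, ih, List.map_cons, List.prod_cons, ← mul_assoc]
      congr 1
      ext1 q
      rw [PowerSeries.coeff_mk, PowerSeries.coeff_mul,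
        Finset.Nat.sum_antidiagonal_eq_sum_range_succ_mk]
      simp only [serMul, twist_sum, twist_sMul, PowerSeries.coeff_mk]
  have h1 : (PowerSeries.mk fun q => twist m (serOne q) :
      PowerSeries (Matrix (Fin l → Fin N) (Fin l → Fin N) R)) = 1 := by
    ext1 q
    rw [PowerSeries.coeff_mk, PowerSeries.coeff_one, serOne]
    split_ifs with h
    · refine twist_eq_self m _ fun r s hrs => Matrix.one_apply_ne fun h => hrs (by rw [h])
    · ext; simp [twist]
  have := congrArg (PowerSeries.coeff p) (key serOne)
  rwa [h1, one_mul, PowerSeries.coeff_mk] at this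

end Untwisting

section Permutations

variable {R : Type} [Ring R] {l N : ℕ}

variable (R N) in
/-- The signed permutation operator on `V^{⊗l}`. -/
abbrev sperm (m : ℕ) (σ : Equiv.Perm (Fin l)) : Matrix (Fin l → Fin N) (Fin l → Fin N) R :=
  permMat m (· < ·) σ

theorem sperm_apply (m : ℕ) (σ : Equiv.Perm (Fin l)) (r s : Fin l → Fin N) :
    sperm R N m σ r s = if r = s ∘ σ.symm then (-1) ^ invExp m (· < ·) σ s else 0 := rfl

theorem sperm_mul_apply (m : ℕ) (σ : Equiv.Perm (Fin l))
    (A : Matrix (Fin l → Fin N) (Fin l → Fin N) R) (r t : Fin l → Fin N) :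
    (sperm R N m σ * A) r t = (-1) ^ invExp m (· < ·) σ (r ∘ σ) * A (r ∘ σ) t := by
  rw [Matrix.mul_apply, Finset.sum_eq_single (r ∘ σ)]
  · simp [permMat, Function.comp_assoc]
  · intro s _ hs
    rw [sperm_apply, if_neg, zero_mul]
    rintro rfl
    exact hs (by simp [Function.comp_assoc])
  · simp

theorem mul_sperm_apply (m : ℕ) (σ : Equiv.Perm (Fin l))
    (A : Matrix (Fin l → Fin N) (Fin l → Fin N) R) (r t : Fin l → Fin N) :
    (A * sperm R N m σ) r t = (-1) ^ invExp m (· < ·) σ t * A r (t ∘ σ.symm) := by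
  rw [Matrix.mul_apply, Finset.sum_eq_single (t ∘ σ.symm)]
  · simp only [permMat, if_true]
    rcases neg_one_pow_eq_or R (invExp m (· < ·) σ t) with h | h <;> simp [h]
  · intro s _ hs
    rw [sperm_apply, if_neg hs, mul_zero]
  · simp

theorem sperm_mul (m : ℕ) (σ τ : Equiv.Perm (Fin l)) :
    sperm R N m (σ * τ) = sperm R N m σ * sperm R N m τ := by
  ext r t
  rw [mul_sperm_apply]
  simp only [permMat]
  have h : t ∘ (σ * τ).symm = (t ∘ τ.symm) ∘ σ.symm := rfl
  rw [h]
  split_ifs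
  · rw [← pow_add]
    apply neg_one_pow_congr_zmod
    push_cast
    rw [cast_invExp_s14, cast_invExp_s14, cast_invExp_s14, invForm_mul, add_comm]
    rfl
  · simp

theorem sperm_one (m : ℕ) : sperm R N m (1 : Equiv.Perm (Fin l)) = 1 := by
  ext r t
  have : (-1 : R) ^ invExp m (· < ·) (1 : Equiv.Perm (Fin l)) t = (-1) ^ 0 := by
    apply neg_one_pow_congr_zmod
    rw [cast_invExp_s14]
    simp only [invForm, Equiv.Perm.one_apply, Nat.cast_zero]
    refine Finset.sum_eq_zero fun x _ => Finset.sum_eq_zero fun y _ => if_neg ?_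
    exact fun h => lt_asymm h.1 h.2
  simp only [permMat, this, Matrix.one_apply, pow_zero]
  rfl

theorem mpar_comp (m : ℕ) (σ : Equiv.Perm (Fin l)) (s : Fin l → Fin N) :
    mpar m (s ∘ σ) = mpar m s := by
  simp only [mpar, Function.comp_apply]
  exact Equiv.sum_comp σ fun x => par m (s x)

theorem grade_mul_sperm (m : ℕ) (σ : Equiv.Perm (Fin l)) :
    grade m * sperm R N m σ = sperm R N m σ * grade m := by
  ext r t
  rw [mul_sperm_apply, sperm_mul_apply]
  simp only [grade, Matrix.diagonal_apply]
  by_cases h : r ∘ σ = t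
  · subst h
    simp [Function.comp_assoc, mpar_comp]
  · have h' : r ≠ t ∘ σ.symm := by
      rintro rfl
      exact h (by simp [Function.comp_assoc])
    simp [h, h']

theorem trace_sperm_mul (m : ℕ) (σ : Equiv.Perm (Fin l))
    (A : Matrix (Fin l → Fin N) (Fin l → Fin N) R) :
    (sperm R N m σ * A).trace = (A * sperm R N m σ).trace := by
  simp only [Matrix.trace, Matrix.diag_apply, sperm_mul_apply, mul_sperm_apply]
  rw [← Equiv.sum_comp (Equiv.arrowCongr σ (Equiv.refl (Fin N)))]
  refine Finset.sum_congr rfl fun r _ => ?_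
  have h : (Equiv.arrowCongr σ (Equiv.refl (Fin N))) r = r ∘ σ.symm := rfl
  simp [h, Function.comp_assoc]

theorem sperm_mul_site (m : ℕ) (σ : Equiv.Perm (Fin l)) (v : Fin l) (f : Fin N → Fin N → R) :
    sperm R N m σ * site m v f = site m (σ v) f * sperm R N m σ := by
  ext r t
  rw [sperm_mul_apply, mul_sperm_apply]
  have hiff : (∀ w, w ≠ v → (r ∘ σ) w = t w) ↔ ∀ w, w ≠ σ v → r w = (t ∘ σ.symm) w := by
    constructor
    · intro h w hw
      have := h (σ.symm w) (fun h' => hw (by simp [← h']))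
      simpa using this
    · intro h w hw
      have := h (σ w) (fun h' => hw (σ.injective h'))
      simpa using this
  simp only [site, ← hiff]
  split_ifs with h
  · simp only [Function.comp_apply, Equiv.symm_apply_apply, ← mul_assoc, ← pow_add]
    congr 1
    apply neg_one_pow_congr_zmod
    have h1 : (mpar m (t ∘ σ.symm) : ZMod 2) = mpar m t := by rw [mpar_comp]
    have h2 := invForm_update σ v (zpar m t) (zpar m (r ∘ σ)) fun w hw => by simp [zpar, ← h w hw]
    have h3 : (∑ w, if w < σ v then (par m (t (σ.symm w)) : ZMod 2) else 0) =
        ∑ w, if σ w < σ v then zpar m t w else 0 := by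
      rw [← Equiv.sum_comp σ]; simp [zpar]
    push_cast
    rw [cast_invExp_s14, cast_invExp_s14, h2]
    simp only [Finset.sum_filter]
    rw [h3, h1]
    simp only [zpar, Function.comp_apply]
    linear_combination ZMod.two_add_self (((par m (r (σ v)) : ZMod 2) + par m (t v)) *
      ∑ w, if w < v then (par m (t w) : ZMod 2) else 0)
  · simp

end Permutations

section ConsTensor

variable {R : Type} [Ring R] {l N : ℕ}

theorem sum_fin_cons (F : (Fin (l + 1) → Fin N) → R) :
    ∑ r, F r = ∑ c : Fin N, ∑ r : Fin l → Fin N, F (Fin.cons c r) := by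
  rw [← Equiv.sum_comp (Fin.consEquiv fun _ => Fin N), Fintype.sum_prod_type]
  rfl

/-- The embedding `X ↦ 1 ⊗ X` of `End(V^{⊗l})` into `End(V^{⊗(l+1)})`. -/
def consHom : Matrix (Fin l → Fin N) (Fin l → Fin N) R →+*
    Matrix (Fin (l + 1) → Fin N) (Fin (l + 1) → Fin N) R where
  toFun X := Matrix.of fun r s => if r 0 = s 0 then X (Fin.tail r) (Fin.tail s) else 0
  map_one' := by
    ext r s
    simp only [Matrix.of_apply, Matrix.one_apply]
    by_cases h : r = s
    · simp [h]
    · rw [if_neg h]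
      split_ifs with h0 h1
      · exact absurd (by rw [← Fin.cons_self_tail r, ← Fin.cons_self_tail s, h0, h1]) h
      · rfl
      · rfl
  map_mul' X Y := by
    ext r t
    rw [Matrix.mul_apply, sum_fin_cons, Finset.sum_eq_single (r 0)]
    · simp only [Matrix.of_apply, Fin.cons_zero, Fin.tail_cons, if_true, Matrix.mul_apply]
      split_ifs <;> simp
    · intro c _ hc
      exact Finset.sum_eq_zero fun s _ => by simp [hc.symm]
    · simp
  map_zero' := by ext; simp
  map_add' X Y := by
    ext r s
    simp only [Matrix.of_apply, Matrix.add_apply]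
    split_ifs <;> simp

theorem consHom_apply (X : Matrix (Fin l → Fin N) (Fin l → Fin N) R) (r s) :
    consHom X r s = if r 0 = s 0 then X (Fin.tail r) (Fin.tail s) else 0 := rfl

theorem mpar_succ (m : ℕ) (r : Fin (l + 1) → Fin N) :
    mpar m r = par m (r 0) + mpar m (Fin.tail r) := by
  simp [mpar, Fin.sum_univ_succ, Fin.tail]

theorem consHom_site (m : ℕ) (v : Fin l) (f : Fin N → Fin N → R) :
    consHom (site m v f) = site m v.succ f := by
  ext r s
  have hiff : (∀ w, w ≠ v.succ → r w = s w) ↔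
      r 0 = s 0 ∧ ∀ w, w ≠ v → Fin.tail r w = Fin.tail s w := by
    rw [Fin.forall_fin_succ]
    simp [(Fin.succ_ne_zero v).symm, Fin.tail]
  simp only [consHom_apply, site, hiff]
  by_cases h0 : r 0 = s 0 <;> by_cases h1 : ∀ w, w ≠ v → Fin.tail r w = Fin.tail s w
  · rw [if_pos h0, if_pos h1, if_pos ⟨h0, h1⟩]
    simp only [Fin.tail]
    congr 1
    apply neg_one_pow_congr_zmod
    simp only [Finset.sum_filter, Fin.sum_univ_succ, mpar_succ]
    simp only [Fin.succ_pos, if_true, Fin.succ_lt_succ_iff]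
    push_cast
    linear_combination -ZMod.two_add_self (((par m (r v.succ) : ZMod 2) + par m (s v.succ)) *
      par m (s 0))
  · rw [if_pos h0, if_neg h1, if_neg fun h => h1 h.2]
  · rw [if_neg h0, if_neg fun h => h0 h.1]
  · rw [if_neg h0, if_neg fun h => h0 h.1]

theorem consHom_sperm (m : ℕ) (e : Equiv.Perm (Fin l)) :
    consHom (sperm R N m e) = sperm R N m (Equiv.Perm.decomposeFin.symm (0, e)) := by
  set σ := Equiv.Perm.decomposeFin.symm (0, e) with hσ
  have h0 : σ 0 = 0 := by simp [hσ]
  have hs : ∀ x : Fin l, σ x.succ = (e x).succ := fun x => by simp [hσ]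
  have h0' : σ.symm 0 = 0 := by rw [Equiv.symm_apply_eq, h0]
  have hs' : ∀ x : Fin l, σ.symm x.succ = (e.symm x).succ := fun x => by
    rw [Equiv.symm_apply_eq, hs, Equiv.apply_symm_apply]
  ext r s
  have hiff : r = s ∘ σ.symm ↔ r 0 = s 0 ∧ Fin.tail r = Fin.tail s ∘ e.symm := by
    rw [funext_iff, Fin.forall_fin_succ, funext_iff]
    simp [h0', hs', Fin.tail]
  have hinv : (-1 : R) ^ invExp m (· < ·) σ s = (-1) ^ invExp m (· < ·) e (Fin.tail s) := by
    apply neg_one_pow_congr_zmod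
    rw [cast_invExp_s14, cast_invExp_s14]
    simp only [invForm, Fin.sum_univ_succ, h0, hs]
    simp [zpar, Fin.tail]
  rw [consHom_apply, sperm_apply, sperm_apply, hinv]
  simp only [hiff, ite_and]

theorem decomposeFin_symm_eq_mul (p : Fin (l + 1)) (e : Equiv.Perm (Fin l)) :
    Equiv.Perm.decomposeFin.symm (p, e) =
      Equiv.swap 0 p * Equiv.Perm.decomposeFin.symm (0, e) := by
  ext x
  refine Fin.cases ?_ (fun x => ?_) x <;> simp

theorem trace_consHom_mul (X : Matrix (Fin l → Fin N) (Fin l → Fin N) R)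
    (S : Matrix (Fin (l + 1) → Fin N) (Fin (l + 1) → Fin N) R) (C : R)
    (hS : ∀ r s : Fin l → Fin N,
      ∑ c : Fin N, S (Fin.cons c s) (Fin.cons c r) = if s = r then C else 0) :
    (consHom X * S).trace = X.trace * C := by
  have h : (consHom X * S).trace = ∑ c : Fin N, ∑ r : Fin l → Fin N, ∑ s : Fin l → Fin N,
      X r s * S (Fin.cons c s) (Fin.cons c r) := by
    simp only [Matrix.trace, Matrix.diag_apply]
    rw [sum_fin_cons]
    refine Finset.sum_congr rfl fun c _ => Finset.sum_congr rfl fun r _ => ?_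
    rw [Matrix.mul_apply, sum_fin_cons, Finset.sum_eq_single c]
    · simp [consHom_apply]
    · intro d _ hd
      exact Finset.sum_eq_zero fun s _ => by simp [consHom_apply, hd.symm]
    · simp
  rw [h, Finset.sum_comm, Matrix.trace, Finset.sum_mul]
  refine Finset.sum_congr rfl fun r _ => ?_
  rw [Finset.sum_comm]
  simp only [← Finset.mul_sum, hS]
  simp

/-- The parity operator of the first tensor factor. -/
def headGrade (m : ℕ) : Matrix (Fin (l + 1) → Fin N) (Fin (l + 1) → Fin N) R :=
  Matrix.diagonal fun r => (-1) ^ par m (r 0)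

theorem headGrade_mul_consHom (m : ℕ) (X : Matrix (Fin l → Fin N) (Fin l → Fin N) R) :
    headGrade m * consHom X = consHom X * headGrade m := by
  ext r s
  simp only [headGrade, Matrix.diagonal_mul, Matrix.mul_diagonal, consHom_apply]
  split_ifs with h
  · rw [h]
    rcases neg_one_pow_eq_or R (par m (s 0)) with h | h <;> simp [h]
  · simp

theorem grade_succ (m : ℕ) :
    (grade m : Matrix (Fin (l + 1) → Fin N) (Fin (l + 1) → Fin N) R) =
      consHom (grade m) * headGrade m := by
  ext r s
  simp only [headGrade, Matrix.mul_diagonal, grade, consHom_apply, Matrix.diagonal_apply]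
  by_cases h : r = s
  · subst h
    simp [mpar_succ, ← pow_add, add_comm]
  · rw [if_neg h]
    split_ifs with h0 h1
    · exact absurd (by rw [← Fin.cons_self_tail r, ← Fin.cons_self_tail s, h0, h1]) h
    · simp
    · simp

/-- The partial supertrace of a transposition `(0 p)` over the first factor. -/
def swapFactor (R : Type) [Ring R] (m N : ℕ) {l : ℕ} (p : Fin (l + 1)) : R :=
  if p = 0 then ∑ c : Fin N, (-1 : R) ^ par m c else 1

theorem sum_headGrade_mul_swap (m : ℕ) (p : Fin (l + 1)) (r s : Fin l → Fin N) :
    ∑ c : Fin N, (headGrade m * sperm R N m (Equiv.swap 0 p) : Matrix _ _ R) (Fin.cons c s) (Fin.cons c r) =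
      if s = r then swapFactor R m N p else 0 := by
  simp only [headGrade, Matrix.diagonal_mul, Fin.cons_zero]
  refine Fin.cases ?_ (fun j => ?_) p
  · rw [Equiv.swap_self]
    change ∑ c : Fin N, (-1) ^ par m c * sperm R N m 1 (Fin.cons c s) (Fin.cons c r) = _
    rw [sperm_one]
    simp only [Matrix.one_apply, (Fin.cons_right_injective _).eq_iff, swapFactor, if_true]
    split_ifs <;> simp
  · rw [swapFactor, if_neg (Fin.succ_ne_zero j)]
    have hiff : ∀ c : Fin N, (Fin.cons c s : Fin (l + 1) → Fin N) =
        (Fin.cons c r : Fin (l + 1) → Fin N) ∘ (Equiv.swap 0 j.succ).symm ↔ s = r ∧ c = r j := by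
      intro c
      rw [funext_iff, Fin.forall_fin_succ, Equiv.symm_swap]
      simp only [Function.comp_apply, Equiv.swap_apply_left, Fin.cons_zero, Fin.cons_succ]
      constructor
      · rintro ⟨h1, h2⟩
        refine ⟨funext fun w => ?_, h1⟩
        rw [h2 w]
        by_cases hw : w = j
        · subst hw; simp [h1]
        · rw [Equiv.swap_apply_of_ne_of_ne (Fin.succ_ne_zero w)
            (fun h => hw (Fin.succ_injective _ h)), Fin.cons_succ]
      · rintro ⟨rfl, rfl⟩
        refine ⟨rfl, fun w => ?_⟩
        by_cases hw : w = j
        · subst hw; simp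
        · rw [Equiv.swap_apply_of_ne_of_ne (Fin.succ_ne_zero w)
            (fun h => hw (Fin.succ_injective _ h)), Fin.cons_succ]
    simp only [sperm_apply, hiff]
    split_ifs with h
    · rw [Finset.sum_eq_single (r j)]
      · rw [if_pos ⟨h, rfl⟩, ← pow_add]
        refine Eq.trans ?_ (pow_zero (-1 : R))
        apply neg_one_pow_congr_zmod
        push_cast
        rw [cast_invExp_s14, invForm_swap j _ (by simp [zpar])]
        simp only [zpar, Fin.cons_zero]
        generalize (par m (r j) : ZMod 2) = x
        revert x
        decide
      · intro c _ hc
        simp [hc]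
      · simp
    · simp [h]

theorem trace_consHom_mul_sperm (m : ℕ) (M : Matrix (Fin l → Fin N) (Fin l → Fin N) R)
    (p : Fin (l + 1)) (e : Equiv.Perm (Fin l)) :
    (grade m * consHom M * sperm R N m (Equiv.Perm.decomposeFin.symm (p, e))).trace =
      (grade m * M * sperm R N m e).trace * swapFactor R m N p := by
  rw [decomposeFin_symm_eq_mul, sperm_mul, ← mul_assoc, ← trace_sperm_mul, ← consHom_sperm,
    grade_succ, mul_assoc (consHom _) (headGrade m), headGrade_mul_consHom]
  simp only [mul_assoc]
  rw [← mul_assoc (consHom (grade m)), ← mul_assoc (consHom (sperm R N m e)), ← map_mul,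
    ← map_mul, trace_consHom_mul _ _ _ (sum_headGrade_mul_swap m p), trace_sperm_mul, mul_assoc]

theorem sum_neg_one_pow_par (m n : ℕ) :
    ∑ c : Fin (m + n), (-1 : R) ^ par m c = (m : R) - n := by
  rw [Fin.sum_univ_add]
  simp [par, parN, sub_eq_add_neg]

end ConsTensor

section AntisymmetrizedTrace

variable {R : Type} [Ring R] [Algebra ℂ R] {l N : ℕ}

/-- The supertrace of `M` multiplied by `l!` times the antisymmetrizer. -/
def altTrace (m : ℕ) (M : Matrix (Fin l → Fin N) (Fin l → Fin N) R) : R :=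
  ∑ σ : Equiv.Perm (Fin l),
    ((Equiv.Perm.sign σ : ℤ) : ℂ) • (grade m * M * sperm R N m σ).trace

theorem altTrace_conj (m : ℕ) (ρ : Equiv.Perm (Fin l))
    (M : Matrix (Fin l → Fin N) (Fin l → Fin N) R) :
    altTrace m (sperm R N m ρ * M * sperm R N m ρ⁻¹) = altTrace m M := by
  unfold altTrace
  rw [← Equiv.sum_comp (MulAut.conj ρ).toEquiv]
  refine Finset.sum_congr rfl fun σ _ => ?_
  have h : (MulAut.conj ρ).toEquiv σ = ρ * σ * ρ⁻¹ := rfl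
  rw [h]
  congr 1
  · rcases Int.units_eq_one_or (Equiv.Perm.sign ρ) with h | h <;> simp [h]
  · have e : grade m * (sperm R N m ρ * M * sperm R N m ρ⁻¹) * sperm R N m (ρ * σ * ρ⁻¹) =
        sperm R N m ρ * (grade m * M * sperm R N m (σ * ρ⁻¹)) := by
      rw [show ρ * σ * ρ⁻¹ = ρ * (σ * ρ⁻¹) by group, sperm_mul m ρ]
      simp only [← mul_assoc]
      rw [grade_mul_sperm, mul_assoc _ (sperm R N m ρ⁻¹) (sperm R N m ρ), ← sperm_mul,
        inv_mul_cancel, sperm_one, mul_one]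
    rw [e, trace_sperm_mul, mul_assoc _ _ (sperm R N m ρ), ← sperm_mul, inv_mul_cancel_right]

theorem altTrace_consHom (m n : ℕ)
    (M : Matrix (Fin l → Fin (m + n)) (Fin l → Fin (m + n)) R) :
    altTrace m (consHom M) = ((m : ℂ) - n - l) • altTrace m M := by
  unfold altTrace
  rw [← Equiv.sum_comp Equiv.Perm.decomposeFin.symm, Fintype.sum_prod_type, Finset.sum_comm,
    Finset.smul_sum]
  refine Finset.sum_congr rfl fun e _ => ?_
  simp only [trace_consHom_mul_sperm, Equiv.Perm.decomposeFin.symm_sign]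
  generalize (grade m * M * sperm R (m + n) m e).trace = t
  rw [Fin.sum_univ_succ]
  simp only [swapFactor, if_true, Fin.succ_ne_zero, if_false, sum_neg_one_pow_par, mul_one,
    one_mul, Finset.sum_const, Finset.card_univ, Fintype.card_fin]
  have hmn : t * ((m : R) - n) = ((m : ℂ) - n) • t := by
    rw [Algebra.smul_def, map_sub, map_natCast, map_natCast, mul_sub, sub_mul,
      Nat.cast_commute m t, Nat.cast_commute n t]
  rw [hmn, ← Nat.cast_smul_eq_nsmul ℂ l]
  simp only [smul_smul, ← add_smul]
  congr 1
  push_cast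
  ring

end AntisymmetrizedTrace

section SiteProducts

variable {R : Type} [Ring R] {k l l' N : ℕ}

/-- The coefficient of index `p` of the product of the operators `q` acting at the sites `i j`
and of the series `f j` acting at the same sites. -/
def siteSeries (m : ℕ) (i : Fin k → Fin l) (q : Fin N → Fin N → R)
    (f : Fin k → ℕ → Fin N → Fin N → R) (p : ℕ) :
    Matrix (Fin l → Fin N) (Fin l → Fin N) R :=
  ((List.finRange k).map fun j => site m (i j) q).prod *
    PowerSeries.coeff p
      ((List.finRange k).map fun j => PowerSeries.mk fun p => site m (i j) (f j p)).prod

theorem map_siteSeries (m : ℕ) (i : Fin k → Fin l) (i' : Fin k → Fin l')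
    (φ : Matrix (Fin l → Fin N) (Fin l → Fin N) R →+*
      Matrix (Fin l' → Fin N) (Fin l' → Fin N) R)
    (hφ : ∀ j g, φ (site m (i j) g) = site m (i' j) g) (q : Fin N → Fin N → R)
    (f : Fin k → ℕ → Fin N → Fin N → R) (p : ℕ) :
    φ (siteSeries m i q f p) = siteSeries m i' q f p := by
  have h : ∀ j, PowerSeries.map φ (PowerSeries.mk fun p => site m (i j) (f j p)) =
      PowerSeries.mk fun p => site m (i' j) (f j p) := fun j => by
    ext1 p
    rw [PowerSeries.coeff_map, PowerSeries.coeff_mk, PowerSeries.coeff_mk, hφ]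
  rw [siteSeries, siteSeries, map_mul, map_list_prod, ← PowerSeries.coeff_map, map_list_prod,
    List.map_map, List.map_map]
  simp only [Function.comp_def, hφ, h]

/-- Conjugation by a signed permutation operator. -/
def spermConj (m : ℕ) (ρ : Equiv.Perm (Fin l)) :
    Matrix (Fin l → Fin N) (Fin l → Fin N) R →+* Matrix (Fin l → Fin N) (Fin l → Fin N) R where
  toFun X := sperm R N m ρ * X * sperm R N m ρ⁻¹
  map_one' := by rw [mul_one, ← sperm_mul, mul_inv_cancel, sperm_one]
  map_mul' X Y := by
    have h : sperm R N m ρ⁻¹ * sperm R N m ρ = 1 := by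
      rw [← sperm_mul, inv_mul_cancel, sperm_one]
    simp only [mul_assoc]
    rw [← mul_assoc (sperm R N m ρ⁻¹) (sperm R N m ρ), h, one_mul]
  map_zero' := by simp
  map_add' X Y := by rw [mul_add, add_mul]

theorem spermConj_apply (m : ℕ) (ρ : Equiv.Perm (Fin l))
    (X : Matrix (Fin l → Fin N) (Fin l → Fin N) R) :
    spermConj m ρ X = sperm R N m ρ * X * sperm R N m ρ⁻¹ := rfl

theorem spermConj_site (m : ℕ) (ρ : Equiv.Perm (Fin l)) (v : Fin l) (f : Fin N → Fin N → R) :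
    spermConj m ρ (site m v f) = site m (ρ v) f := by
  rw [spermConj_apply, sperm_mul_site, mul_assoc, ← sperm_mul, mul_inv_cancel, sperm_one, mul_one]

theorem altTrace_siteSeries_congr [Algebra ℂ R] (m : ℕ) {i i' : Fin k → Fin l}
    (hi : Function.Injective i) (hi' : Function.Injective i') (q : Fin N → Fin N → R)
    (f : Fin k → ℕ → Fin N → Fin N → R) (p : ℕ) :
    altTrace m (siteSeries m i q f p) = altTrace m (siteSeries m i' q f p) := by
  obtain ⟨ρ, hρ⟩ := Equiv.Perm.exists_extending_pair i i' hi hi'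
  rw [← altTrace_conj m ρ, ← spermConj_apply]
  refine congrArg _ (map_siteSeries m i i' _ (fun j g => ?_) q f p)
  rw [spermConj_site, hρ]

theorem altTrace_siteSeries [Algebra ℂ R] (m n : ℕ) (hkl : k ≤ l) {i : Fin k → Fin l}
    {i₀ : Fin k → Fin k} (hi : Function.Injective i) (hi₀ : Function.Injective i₀)
    (q : Fin (m + n) → Fin (m + n) → R)
    (f : Fin k → ℕ → Fin (m + n) → Fin (m + n) → R) (p : ℕ) :
    altTrace m (siteSeries m i q f p) =
      (∏ j ∈ Finset.Ico k l, ((m : ℂ) - (n : ℂ) - (j : ℕ))) •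
        altTrace m (siteSeries m i₀ q f p) := by
  induction l, hkl using Nat.le_induction with
  | base => rw [Finset.Ico_self, Finset.prod_empty, one_smul, altTrace_siteSeries_congr m hi hi₀]
  | succ l hkl ih =>
    have hc : Function.Injective (Fin.castLE hkl) := Fin.castLE_injective hkl
    rw [altTrace_siteSeries_congr m hi ((Fin.succ_injective l).comp hc),
      ← map_siteSeries m (Fin.castLE hkl) (Fin.succ ∘ Fin.castLE hkl) consHom (fun j g => consHom_site m _ g),
      altTrace_consHom, ih hc, Finset.prod_Ico_succ_top hkl, smul_smul, mul_comm]

theorem preservesParity_list_prod (m : ℕ)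
    (L : List (Matrix (Fin l → Fin N) (Fin l → Fin N) R))
    (h : ∀ A ∈ L, PreservesParity m A) : PreservesParity m L.prod := by
  induction L with
  | nil => exact fun r s hrs => Matrix.one_apply_ne fun h => hrs (by rw [h])
  | cons A L ih =>
    intro r s hrs
    rw [List.prod_cons, Matrix.mul_apply]
    refine Finset.sum_eq_zero fun t _ => ?_
    by_cases hrt : (mpar m r : ZMod 2) = mpar m t
    · rw [ih (fun B hB => h B (List.mem_cons_of_mem A hB)) t s (hrt ▸ hrs), mul_zero]
    · rw [h A List.mem_cons_self r t hrt, zero_mul]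

theorem embed_list_prod_apply (m : ℕ) (Q : Matrix (Fin N) (Fin N) ℂ)
    (hQ : ∀ a b, par m a ≠ par m b → Q a b = 0) (L : List (Fin l)) (hL : L.Nodup)
    (r s : Fin l → Fin N) :
    (L.map fun v => embed m (· < ·) v fun a b => Q a b).prod r s =
      if ∀ w, w ∉ L → r w = s w then (L.map fun v => Q (r v) (s v)).prod else 0 := by
  induction L generalizing r with
  | nil => simp [Matrix.one_apply, funext_iff]
  | cons v L ih =>
    obtain ⟨hv, hL⟩ := List.nodup_cons.1 hL
    rw [List.map_cons, List.prod_cons, Matrix.mul_apply,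
      Finset.sum_eq_single (Function.update r v (s v))]
    · rw [ih hL, embed_even_apply m v _ hQ, if_pos fun w hw => by simp [hw]]
      have h1 : (∀ w, w ∉ L → Function.update r v (s v) w = s w) ↔
          ∀ w, w ∉ v :: L → r w = s w := by
        refine forall_congr' fun w => ?_
        by_cases hw : w = v
        · subst hw; simp
        · simp [hw]
      have h2 : (L.map fun x => Q (Function.update r v (s v) x) (s x)) =
          L.map fun x => Q (r x) (s x) := by
        refine List.map_congr_left fun x hx => ?_
        rw [Function.update_of_ne (fun h => hv (by rwa [← h]))]
      simp only [h1, h2]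
      split_ifs <;> simp
    · intro t _ ht
      rw [ih hL, embed_even_apply m v _ hQ]
      by_cases h1 : ∀ w, w ≠ v → r w = t w
      · rw [if_neg (c := ∀ w, w ∉ L → t w = s w), mul_zero]
        intro h2
        refine ht (funext fun w => ?_)
        by_cases hw : w = v
        · subst hw; simp [h2 w hv]
        · simp [hw, h1 w hw]
      · rw [if_neg h1, zero_mul]
    · simp

theorem kron_eq_prod_embed (m : ℕ) (Q : Matrix (Fin N) (Fin N) ℂ)
    (hQ : ∀ a b, par m a ≠ par m b → Q a b = 0) {i : Fin k → Fin k} (hi : Function.Injective i) :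
    kron Q = ((List.finRange k).map fun j => embed m (· < ·) (i j) fun a b => Q a b).prod := by
  have hL : ((List.finRange k).map i).Nodup := (List.nodup_finRange k).map hi
  have hmem : ∀ w, w ∈ (List.finRange k).map i := fun w => by
    simpa using (Finite.injective_iff_surjective.1 hi) w
  ext r s
  have h := embed_list_prod_apply m Q hQ _ hL r s
  rw [List.map_map] at h
  rw [show ((List.finRange k).map fun j => embed m (· < ·) (i j) fun a b => Q a b) =
    (List.finRange k).map ((fun v => embed m (· < ·) v fun a b => Q a b) ∘ i) from rfl, h,
    if_pos fun w hw => absurd (hmem w) hw, kron, ← List.prod_toFinset _ hL]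
  exact Finset.prod_congr (by ext w; simpa using hmem w) fun _ _ => rfl

theorem twist_map_prod_embed [Algebra ℂ R] (m : ℕ) (Q : Matrix (Fin N) (Fin N) ℂ)
    (hQ : ∀ a b, par m a ≠ par m b → Q a b = 0) (i : Fin k → Fin l) :
    twist m ((((List.finRange k).map fun j =>
        embed m (· < ·) (i j) fun a b => Q a b).prod).map (algebraMap ℂ R)) =
      ((List.finRange k).map fun j => site m (i j) fun a b => algebraMap ℂ R (Q a b)).prod := by
  have hQ' : ∀ a b, par m a ≠ par m b → algebraMap ℂ R (Q a b) = 0 := fun a b h => by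
    rw [hQ a b h, map_zero]
  have h : ∀ v : Fin l, (algebraMap ℂ R).mapMatrix (embed m (· < ·) v fun a b => Q a b) =
      embed m (· < ·) v fun a b => algebraMap ℂ R (Q a b) := fun v => by
    ext r s
    simp only [RingHom.mapMatrix_apply, Matrix.map_apply, embed]
    split_ifs <;> simp
  rw [← RingHom.mapMatrix_apply, map_list_prod, List.map_map]
  simp only [Function.comp_def, h, site_even m _ _ hQ']
  refine twist_eq_self m _ (preservesParity_list_prod m _ fun A hA => ?_)
  obtain ⟨j, -, rfl⟩ := List.mem_map.1 hA
  exact preservesParity_embed m _ _ hQ'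

theorem map_asymmZ [Algebra ℂ R] (m : ℕ) :
    (asymmZ m N l).map (algebraMap ℂ R) = ((l.factorial : ℂ))⁻¹ •
      ∑ σ : Equiv.Perm (Fin l), ((Equiv.Perm.sign σ : ℤ) : ℂ) • sperm R N m σ := by
  ext r s
  have h : asymmZ m N l r s = (l.factorial : ℂ)⁻¹ *
      ∑ σ : Equiv.Perm (Fin l), ((Equiv.Perm.sign σ : ℤ) : ℂ) * permMat m (· < ·) σ r s := by
    simp [asymmZ, Matrix.smul_apply, Matrix.sum_apply]
  rw [Matrix.map_apply, h, map_mul, map_sum, Matrix.smul_apply, Matrix.sum_apply,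
    Algebra.smul_def]
  congr 1
  refine Finset.sum_congr rfl fun σ _ => ?_
  rw [map_mul, Matrix.smul_apply, Algebra.smul_def, sperm_apply]
  congr 1
  simp only [permMat]
  split_ifs <;> simp

theorem twist_map_asymmZ [Algebra ℂ R] (m : ℕ) :
    twist m ((asymmZ m N l).map (algebraMap ℂ R)) = ((l.factorial : ℂ))⁻¹ •
      ∑ σ : Equiv.Perm (Fin l), ((Equiv.Perm.sign σ : ℤ) : ℂ) • sperm R N m σ := by
  rw [map_asymmZ]
  refine twist_eq_self m _ fun r s hrs => ?_
  have h : ∀ σ : Equiv.Perm (Fin l), sperm R N m σ r s = 0 := fun σ => by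
    rw [sperm_apply, if_neg]
    rintro rfl
    exact hrs (by rw [mpar_comp])
  simp [Matrix.smul_apply, Matrix.sum_apply, h]

theorem trace_grade_mul_asymm [Algebra ℂ R] (m : ℕ)
    (M : Matrix (Fin l → Fin N) (Fin l → Fin N) R) :
    (grade m * (M * twist m ((asymmZ m N l).map (algebraMap ℂ R)))).trace =
      ((l.factorial : ℂ))⁻¹ • altTrace m M := by
  rw [twist_map_asymmZ, altTrace]
  simp only [Matrix.mul_smul, Matrix.mul_sum, Matrix.trace_smul, Matrix.trace_sum, mul_assoc]

theorem trace_grade_asymm_mul [Algebra ℂ R] (m : ℕ)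
    (M : Matrix (Fin l → Fin N) (Fin l → Fin N) R) :
    (grade m * (twist m ((asymmZ m N l).map (algebraMap ℂ R)) * M)).trace =
      ((l.factorial : ℂ))⁻¹ • altTrace m M := by
  have h : ∀ σ : Equiv.Perm (Fin l), (grade m * M * sperm R N m σ).trace =
      (grade m * (sperm R N m σ * M)).trace := fun σ => by
    rw [← trace_sperm_mul, ← mul_assoc, ← grade_mul_sperm, mul_assoc]
  rw [twist_map_asymmZ, altTrace]
  simp only [Matrix.mul_smul, Matrix.mul_sum, Matrix.smul_mul, Matrix.sum_mul, Matrix.trace_smul,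
    Matrix.trace_sum, h]

/-- The coefficients of the series `T_{ab}(u - z)`. -/
def shiftedT (m n : ℕ) (z : ℂ) (p : ℕ) (a b : Fin (m + n)) : Yangian m n :=
  ∑ s ∈ Finset.range (p + 1), algebraMap ℂ (Yangian m n) (shiftCoeff z p s) * TT m n a b s

theorem twist_serProd_TfacY (m n : ℕ) (i : Fin k → Fin l) (z : Fin k → ℂ) (p : ℕ) :
    twist m (serProd m ((List.finRange k).map fun j => TfacY m n (· < ·) (i j) (z j)) p) =
      PowerSeries.coeff p ((List.finRange k).map fun j =>
        PowerSeries.mk fun p => site m (i j) (shiftedT m n (z j) p)).prod := by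
  rw [coeff_prod_twist, List.map_map]
  simp only [Function.comp_def, TfacY, twist_embed]
  rfl

theorem transferT_eq_altTrace (m n : ℕ) (hk : 1 ≤ k) (Q : Matrix (Fin (m + n)) (Fin (m + n)) ℂ)
    (hQ : ∀ a b, par m a ≠ par m b → Q a b = 0) (p : ℕ) :
    transferT m n k Q p = ((k.factorial : ℂ))⁻¹ • altTrace m
      (siteSeries m (Fin.rev : Fin k → Fin k) (fun a b => algebraMap ℂ (Yangian m n) (Q a b))
        (fun j => shiftedT m n ((j : ℕ) : ℂ)) p) := by
  have hz : TwedgeProd m n k = serProd m ((List.finRange k).map fun j =>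
      TfacY m n (· < ·) (Fin.rev j) ((j : ℕ) : ℂ)) := by
    rw [TwedgeProd, List.finRange_reverse, List.map_map]
    congr 1
    refine List.map_congr_left fun j _ => ?_
    have : (k : ℂ) - 1 - ((Fin.rev j : Fin k) : ℕ) = ((j : ℕ) : ℂ) := by
      rw [Fin.val_rev, Nat.cast_sub (by omega)]
      push_cast
      ring
    simp only [Function.comp_apply, this]
  rw [transferT, if_neg (by omega), strace_eq_trace, twist_sMul, twist_sMul,
    trace_grade_asymm_mul, kron_eq_prod_embed m Q hQ Fin.rev_injective, twist_map_prod_embed m Q hQ,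
    hz, twist_serProd_TfacY, siteSeries]

end SiteProducts

theorem statement14 (m n k l : ℕ) (hk : 1 ≤ k) (hkl : k ≤ l)
    (Q : Matrix (Fin (m + n)) (Fin (m + n)) ℂ) (hQeven : ∀ a b, par m a ≠ par m b → Q a b = 0)
    (i : Fin k → Fin l) (hi : Function.Injective i) :
    ∀ p : ℕ,
      strace m
        (sMul m
          ((((List.finRange k).map fun j =>
              embed m (· < ·) (i j) (fun a b => Q a b)).prod).map (algebraMap ℂ (Yangian m n)))
          (sMul m
            ((serProd m ((List.finRange k).map fun j =>
                TfacY m n (· < ·) (i j) ((j : ℕ) : ℂ))) p)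
            ((asymmZ m (m + n) l).map (algebraMap ℂ (Yangian m n)))))
      = (((k.factorial : ℂ) / (l.factorial : ℂ)) *
          ∏ j ∈ Finset.Ico k l, ((m : ℂ) - (n : ℂ) - (j : ℕ))) • transferT m n k Q p := by
  intro p
  rw [strace_eq_trace, twist_sMul, twist_sMul, ← mul_assoc (twist m _), trace_grade_mul_asymm,
    twist_map_prod_embed m Q hQeven, twist_serProd_TfacY m n i fun j => ((j : ℕ) : ℂ),
    transferT_eq_altTrace m n hk Q hQeven]
  change _ • altTrace m (siteSeries m i _ (fun j => shiftedT m n ((j : ℕ) : ℂ)) p) = _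
  rw [altTrace_siteSeries m n hkl hi Fin.rev_injective, smul_smul, smul_smul]
  congr 1
  have : (k.factorial : ℂ) ≠ 0 := Nat.cast_ne_zero.2 k.factorial_ne_zero
  field_simp

end Paper
end
end
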